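/- Let λ be the partition of n whose Young diagram is a union of m rectangles of sizes p_i × q_i (i = 1,…,m) with q_1 ≥ q_2 ≥ ⋯ ≥ q_m, i.e., λ has p_m parts equal to q_m, then p_{m-1} parts equal to q_{m-1}, …, then p_1 parts equal to q_1, read from the bottom up, so that n = Σ_{i=1}^m p_i q_i. Fix k ≥ 1 with k ≤ n and let μ be a partition of k. Then the normalized character value F_μ(p_1,…,p_m; q_1,…,q_m) = χ̂^λ(μ,1^{n-k}) is a polynomial function of p_1,…,p_m and q_1,…,q_m with integer coefficients. -/

import Mathlib

open Equiv Finset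

/-- The `r`-th power sum polynomial in `n` variables. -/
noncomputable def psum (n r : ℕ) : MvPolynomial (Fin n) ℤ :=
  ∑ i : Fin n, MvPolynomial.X i ^ r

/-- The Vandermonde product `∏_{i<j} (x_i - x_j)`. -/
noncomputable def vdm (n : ℕ) : MvPolynomial (Fin n) ℤ :=
  ∏ i : Fin n, ∏ j ∈ Finset.univ.filter (fun j => i < j),
    (MvPolynomial.X i - MvPolynomial.X j)

/-- The `i`-th largest part of a partition (`0`-indexed; `0` if `i` exceeds the
number of parts). -/
def nthPart {n : ℕ} (lam : n.Partition) (i : ℕ) : ℕ :=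
  ((lam.parts.sort (· ≤ ·)).reverse).getD i 0

/-- The value `χ^λ(μ)` of the irreducible character of the symmetric group `S_n`
indexed by the partition `λ` of `n` on permutations of cycle type `μ`, defined via
the Frobenius character formula: `χ^λ(μ)` is the coefficient of
`x^{λ₁+n-1} x₂^{λ₂+n-2} ⋯ xₙ^{λₙ}` in `∏_{i<j}(x_i-x_j) · ∏_r p_{μ_r}(x)`. -/
noncomputable def chi (n : ℕ) (lam mu : n.Partition) : ℤ :=
  MvPolynomial.coeff
    (Finsupp.equivFunOnFinite.symm fun i : Fin n => nthPart lam i + (n - 1 - i))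
    (vdm n * (mu.parts.map (psum n)).prod)

/-- The partition `(μ, 1^{n-k})` of `n` obtained from a partition `μ` of `k ≤ n`
by appending `n - k` parts equal to `1`. -/
def padOnes {k : ℕ} (n : ℕ) (h : k ≤ n) (mu : Nat.Partition k) : Nat.Partition n where
  parts := mu.parts + Multiset.replicate (n - k) 1
  parts_pos := by
    intro i hi
    rcases Multiset.mem_add.mp hi with h' | h'
    · exact mu.parts_pos h'
    · simpa [Multiset.eq_of_mem_replicate h'] using Nat.one_pos
  parts_sum := by
    simp [Multiset.sum_replicate, mu.parts_sum]
    omega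

/-- The partition of `n` into `n` parts equal to `1`. -/
def onesPartition (n : ℕ) : Nat.Partition n where
  parts := Multiset.replicate n 1
  parts_pos := by
    intro i hi
    simpa [Multiset.eq_of_mem_replicate hi] using Nat.one_pos
  parts_sum := by simp [Multiset.sum_replicate]

/-- The normalized character `χ̂^λ(μ, 1^{n-k}) = (n)_k χ^λ(μ,1^{n-k}) / χ^λ(1^n)`. -/
noncomputable def chihat {k : ℕ} (n : ℕ) (h : k ≤ n) (lam : n.Partition)
    (mu : Nat.Partition k) : ℚ :=
  (n.descFactorial k : ℚ) * (chi n lam (padOnes n h mu) : ℚ) / (chi n lam (onesPartition n) : ℚ)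

/-- `n = ∑ pᵢ qᵢ`, the size of a union of `m` rectangles `pᵢ × qᵢ`. -/
def rectN (m : ℕ) (p q : Fin m → ℕ) : ℕ := ∑ i : Fin m, p i * q i

/-- The partition whose Young diagram is the union of `m` rectangles of sizes
`pᵢ × qᵢ` (with `q₁ ≥ ⋯ ≥ q_m`): it has `pᵢ` parts equal to `qᵢ` for each `i`. -/
def rectShape (m : ℕ) (p q : Fin m → ℕ) (hq : ∀ i, 0 < q i) :
    Nat.Partition (rectN m p q) where
  parts := ∑ i : Fin m, Multiset.replicate (p i) (q i)
  parts_pos := by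
    intro j hj
    rw [Multiset.mem_sum] at hj
    obtain ⟨i, -, hji⟩ := hj
    rw [Multiset.eq_of_mem_replicate hji]
    exact hq i
  parts_sum := by
    rw [Multiset.sum_sum]
    simp [Multiset.sum_replicate, rectN, mul_comm]

section Operators
open Polynomial

/-- The derivation `X r ↦ (r + 1) w^(r+1)`, where `w` is the polynomial variable. Here and below
`X r` stands for the power sum `p_{r+1}`, and `w` for a marked variable. -/
noncomputable def joinDer : Derivation ℤ (MvPolynomial ℕ ℤ) (MvPolynomial ℕ ℤ)[X] :=
  MvPolynomial.mkDerivation ℤ fun r => ((r + 1 : ℕ) : (MvPolynomial ℕ ℤ)[X]) * X ^ (r + 1)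

/-- The operator `f w^c ↦ w^c (joinDer f + w f)`. -/
noncomputable def joinOp : (MvPolynomial ℕ ℤ)[X] →ₗ[ℤ] (MvPolynomial ℕ ℤ)[X] :=
  Polynomial.lsum fun c => (LinearMap.mulLeft ℤ (X ^ c)) ∘ₗ
    ((joinDer : MvPolynomial ℕ ℤ →ₗ[ℤ] (MvPolynomial ℕ ℤ)[X]) +
      (LinearMap.mulLeft ℤ X) ∘ₗ (Polynomial.CAlgHom (R := ℤ) (A := MvPolynomial ℕ ℤ)).toLinearMap)

/-- The sum of the `X r * w^(c-1-r)` for `r < c`. -/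
noncomputable def cutSum (c : ℕ) : (MvPolynomial ℕ ℤ)[X] :=
  ∑ r ∈ range c, C (MvPolynomial.X r) * X ^ (c - 1 - r)

/-- The linear operator `w^c ↦ cutSum c`. -/
noncomputable def cutOp : (MvPolynomial ℕ ℤ)[X] →ₗ[MvPolynomial ℕ ℤ] (MvPolynomial ℕ ℤ)[X] :=
  Polynomial.lsum fun c => LinearMap.toSpanSingleton _ _ (cutSum c)

/-- The linear map `w^c ↦ X c`. -/
noncomputable def closeOp : (MvPolynomial ℕ ℤ)[X] →ₗ[MvPolynomial ℕ ℤ] MvPolynomial ℕ ℤ :=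
  Polynomial.lsum fun c => LinearMap.toSpanSingleton _ _ (MvPolynomial.X c)

lemma joinOp_C_mul_X_pow (f : MvPolynomial ℕ ℤ) (c : ℕ) :
    joinOp (C f * X ^ c) = X ^ c * (joinDer f + X * C f) := by
  rw [C_mul_X_pow_eq_monomial]
  simp [joinOp, Polynomial.lsum_apply, Polynomial.sum_monomial_index]

lemma cutOp_C_mul_X_pow (f : MvPolynomial ℕ ℤ) (c : ℕ) :
    cutOp (C f * X ^ c) = C f * cutSum c := by
  rw [C_mul_X_pow_eq_monomial]
  simp [cutOp, Polynomial.lsum_apply, Polynomial.sum_monomial_index, Polynomial.smul_eq_C_mul]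

lemma closeOp_C_mul_X_pow (f : MvPolynomial ℕ ℤ) (c : ℕ) :
    closeOp (C f * X ^ c) = f * MvPolynomial.X c := by
  rw [C_mul_X_pow_eq_monomial]
  simp [closeOp, Polynomial.lsum_apply, Polynomial.sum_monomial_index]

lemma polynomial_induction_C_mul_X_pow {p : (MvPolynomial ℕ ℤ)[X] → Prop}
    (add : ∀ F G, p F → p G → p (F + G)) (mono : ∀ f c, p (C f * X ^ c)) (G) : p G := by
  induction G using Polynomial.induction_on' with
  | add F G hF hG => exact add F G hF hG
  | monomial c f => rw [← C_mul_X_pow_eq_monomial]; exact mono f c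

lemma cutOp_C_mul (f : MvPolynomial ℕ ℤ) (G : (MvPolynomial ℕ ℤ)[X]) :
    cutOp (C f * G) = C f * cutOp G := by
  rw [← Polynomial.smul_eq_C_mul, map_smul, Polynomial.smul_eq_C_mul]

lemma closeOp_C_mul (f : MvPolynomial ℕ ℤ) (G : (MvPolynomial ℕ ℤ)[X]) :
    closeOp (C f * G) = f * closeOp G := by
  rw [← Polynomial.smul_eq_C_mul, map_smul, smul_eq_mul]

lemma cutOp_C (f : MvPolynomial ℕ ℤ) : cutOp (C f) = 0 := by
  simpa [cutSum] using cutOp_C_mul_X_pow f 0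

lemma cutOp_X_pow (c : ℕ) : cutOp (X ^ c) = cutSum c := by
  simpa using cutOp_C_mul_X_pow 1 c

lemma closeOp_X_pow (c : ℕ) : closeOp (X ^ c) = MvPolynomial.X c := by
  simpa using closeOp_C_mul_X_pow 1 c

lemma joinOp_C (f : MvPolynomial ℕ ℤ) : joinOp (C f) = joinDer f + X * C f := by
  simpa using joinOp_C_mul_X_pow f 0

lemma joinDer_X_mul (j : ℕ) (f : MvPolynomial ℕ ℤ) :
    joinDer (MvPolynomial.X j * f) =
      C (MvPolynomial.X j) * joinDer f + ((j : (MvPolynomial ℕ ℤ)[X]) + 1) * X ^ (j + 1) * C f := by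
  rw [Derivation.leibniz, joinDer, MvPolynomial.mkDerivation_X, Polynomial.smul_eq_C_mul,
    Polynomial.smul_eq_C_mul]
  push_cast
  ring

lemma joinOp_X_pow_mul (r : ℕ) (G : (MvPolynomial ℕ ℤ)[X]) :
    joinOp (X ^ r * G) = X ^ r * joinOp G := by
  induction G using polynomial_induction_C_mul_X_pow with
  | add F G hF hG => rw [mul_add, map_add, map_add, hF, hG, mul_add]
  | mono f c =>
    rw [show X ^ r * (C f * X ^ c) = C f * X ^ (r + c) by ring, joinOp_C_mul_X_pow,
      joinOp_C_mul_X_pow]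
    ring

lemma joinOp_C_X_mul (j : ℕ) (G : (MvPolynomial ℕ ℤ)[X]) :
    joinOp (C (MvPolynomial.X j) * G) =
      C (MvPolynomial.X j) * joinOp G + ((j : (MvPolynomial ℕ ℤ)[X]) + 1) * X ^ (j + 1) * G := by
  induction G using polynomial_induction_C_mul_X_pow with
  | add F G hF hG => rw [mul_add, map_add, map_add, hF, hG]; ring
  | mono f c =>
    rw [← mul_assoc, ← C_mul, joinOp_C_mul_X_pow, joinOp_C_mul_X_pow, joinDer_X_mul, C_mul]
    ring

/-- The Euler operator `w^c ↦ c w^c` of the marked variable. -/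
noncomputable def markDeg : (MvPolynomial ℕ ℤ)[X] →ₗ[MvPolynomial ℕ ℤ] (MvPolynomial ℕ ℤ)[X] :=
  LinearMap.mulLeft _ X ∘ₗ derivative

lemma markDeg_C_mul (f : MvPolynomial ℕ ℤ) (G : (MvPolynomial ℕ ℤ)[X]) :
    markDeg (C f * G) = C f * markDeg G := by
  rw [← Polynomial.smul_eq_C_mul, map_smul, Polynomial.smul_eq_C_mul]

lemma markDeg_mul (F G : (MvPolynomial ℕ ℤ)[X]) :
    markDeg (F * G) = markDeg F * G + F * markDeg G := by
  simp [markDeg]; ring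

lemma markDeg_X_pow (c : ℕ) : markDeg (X ^ c) = (c : (MvPolynomial ℕ ℤ)[X]) * X ^ c := by
  cases c with
  | zero => simp [markDeg]
  | succ c => simp [markDeg]; ring

/-- The sum of the cut and join operators: the Lax operator of the cut-and-join operator. -/
noncomputable def laxOp : (MvPolynomial ℕ ℤ)[X] →ₗ[ℤ] (MvPolynomial ℕ ℤ)[X] :=
  cutOp.restrictScalars ℤ + joinOp

lemma laxOp_apply (G : (MvPolynomial ℕ ℤ)[X]) : laxOp G = cutOp G + joinOp G := rfl

lemma laxOp_C (f : MvPolynomial ℕ ℤ) : laxOp (C f) = joinOp (C f) := by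
  rw [laxOp_apply, cutOp_C, zero_add]

lemma laxOp_C_X_mul (j : ℕ) (G : (MvPolynomial ℕ ℤ)[X]) :
    laxOp (C (MvPolynomial.X j) * G) =
      C (MvPolynomial.X j) * laxOp G + ((j : (MvPolynomial ℕ ℤ)[X]) + 1) * X ^ (j + 1) * G := by
  rw [laxOp_apply, joinOp_C_X_mul, cutOp_C_mul, laxOp_apply]; ring

/-- The linear map `1 ↦ 0`, `w^(c+1) ↦ X c`. -/
noncomputable def traceOp : (MvPolynomial ℕ ℤ)[X] →ₗ[MvPolynomial ℕ ℤ] MvPolynomial ℕ ℤ :=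
  Polynomial.lsum fun c => Nat.casesOn c 0 fun c =>
    LinearMap.toSpanSingleton _ _ (MvPolynomial.X c)

lemma traceOp_C_mul (f : MvPolynomial ℕ ℤ) (G : (MvPolynomial ℕ ℤ)[X]) :
    traceOp (C f * G) = f * traceOp G := by
  rw [← Polynomial.smul_eq_C_mul, map_smul, smul_eq_mul]

lemma traceOp_one : traceOp 1 = 0 := by
  rw [← C_1, ← monomial_zero_left, traceOp, Polynomial.lsum_apply, Polynomial.sum_monomial_index] <;> simp

lemma traceOp_C (f : MvPolynomial ℕ ℤ) : traceOp (C f) = 0 := by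
  rw [← mul_one (C f), traceOp_C_mul, traceOp_one, mul_zero]

lemma traceOp_X_pow_succ (c : ℕ) : traceOp (X ^ (c + 1)) = MvPolynomial.X c := by
  rw [X_pow_eq_monomial, traceOp, Polynomial.lsum_apply, Polynomial.sum_monomial_index] <;> simp

lemma traceOp_X_mul (G : (MvPolynomial ℕ ℤ)[X]) : traceOp (X * G) = closeOp G := by
  induction G using polynomial_induction_C_mul_X_pow with
  | add F G hF hG => rw [mul_add, map_add, map_add, hF, hG]
  | mono f c =>
    rw [show X * (C f * X ^ c) = C f * X ^ (c + 1) by ring, traceOp_C_mul, traceOp_X_pow_succ,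
      closeOp_C_mul_X_pow]

/-- Twice the cut-and-join operator, as a matrix coefficient of the square of `laxOp`. -/
noncomputable def cutJoinOp : MvPolynomial ℕ ℤ →ₗ[ℤ] MvPolynomial ℕ ℤ :=
  traceOp.restrictScalars ℤ ∘ₗ laxOp ∘ₗ laxOp ∘ₗ
    (Polynomial.CAlgHom (R := ℤ) (A := MvPolynomial ℕ ℤ)).toLinearMap

lemma cutJoinOp_apply (f : MvPolynomial ℕ ℤ) :
    cutJoinOp f = traceOp (laxOp (laxOp (C f))) := rfl

/-- The first-order operator `f ↦ closeOp (w^r laxOp f)`. -/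
noncomputable def shiftOp (r : ℕ) : MvPolynomial ℕ ℤ →ₗ[ℤ] MvPolynomial ℕ ℤ :=
  closeOp.restrictScalars ℤ ∘ₗ LinearMap.mulLeft ℤ (X ^ r) ∘ₗ laxOp ∘ₗ
    (Polynomial.CAlgHom (R := ℤ) (A := MvPolynomial ℕ ℤ)).toLinearMap

lemma shiftOp_apply (r : ℕ) (f : MvPolynomial ℕ ℤ) :
    shiftOp r f = closeOp (X ^ r * laxOp (C f)) := rfl

lemma shiftOp_X_mul (r j : ℕ) (f : MvPolynomial ℕ ℤ) :
    shiftOp r (MvPolynomial.X j * f) =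
      MvPolynomial.X j * shiftOp r f + ((j : MvPolynomial ℕ ℤ) + 1) * MvPolynomial.X (r + j + 1) * f := by
  rw [shiftOp_apply, C_mul, laxOp_C_X_mul, mul_add,
    show X ^ r * (C (MvPolynomial.X j) * laxOp (C f)) =
      C (MvPolynomial.X j) * (X ^ r * laxOp (C f)) by ring, map_add, closeOp_C_mul, shiftOp_apply,
    show X ^ r * (((j : (MvPolynomial ℕ ℤ)[X]) + 1) * X ^ (j + 1) * C f) =
      C (((j : MvPolynomial ℕ ℤ) + 1) * f) * X ^ (r + j + 1) by simp; ring, closeOp_C_mul_X_pow]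
  ring

lemma shiftOp_one (r : ℕ) : shiftOp r 1 = MvPolynomial.X (r + 1) := by
  rw [shiftOp_apply, laxOp_C, joinOp_C, Derivation.map_one_eq_zero, zero_add, C_1, mul_one,
    ← pow_succ, closeOp_X_pow]

/-- The extension of an operator to polynomials in `w`, coefficient by coefficient. -/
noncomputable def coeffwise (T : MvPolynomial ℕ ℤ →ₗ[ℤ] MvPolynomial ℕ ℤ) :
    (MvPolynomial ℕ ℤ)[X] →ₗ[ℤ] (MvPolynomial ℕ ℤ)[X] :=
  Polynomial.lsum fun c => LinearMap.mulLeft ℤ (X ^ c) ∘ₗ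
    (Polynomial.CAlgHom (R := ℤ) (A := MvPolynomial ℕ ℤ)).toLinearMap ∘ₗ T

lemma coeffwise_C_mul_X_pow (T : MvPolynomial ℕ ℤ →ₗ[ℤ] MvPolynomial ℕ ℤ) (f : MvPolynomial ℕ ℤ)
    (c : ℕ) : coeffwise T (C f * X ^ c) = C (T f) * X ^ c := by
  rw [C_mul_X_pow_eq_monomial, coeffwise, Polynomial.lsum_apply, Polynomial.sum_monomial_index]
  · exact mul_comm (X ^ c) (C (T f))
  · exact map_zero _

lemma coeffwise_C (T : MvPolynomial ℕ ℤ →ₗ[ℤ] MvPolynomial ℕ ℤ) (f : MvPolynomial ℕ ℤ) :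
    coeffwise T (C f) = C (T f) := by
  simpa using coeffwise_C_mul_X_pow T f 0

lemma coeffwise_X_pow_mul (T : MvPolynomial ℕ ℤ →ₗ[ℤ] MvPolynomial ℕ ℤ) (r : ℕ)
    (G : (MvPolynomial ℕ ℤ)[X]) : coeffwise T (X ^ r * G) = X ^ r * coeffwise T G := by
  induction G using polynomial_induction_C_mul_X_pow with
  | add F G hF hG => rw [mul_add, map_add, map_add, hF, hG, mul_add]
  | mono f c =>
    rw [show X ^ r * (C f * X ^ c) = C f * X ^ (r + c) by ring, coeffwise_C_mul_X_pow,
      coeffwise_C_mul_X_pow]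
    ring

lemma coeffwise_shiftOp_C_X_mul (r j : ℕ) (G : (MvPolynomial ℕ ℤ)[X]) :
    coeffwise (shiftOp r) (C (MvPolynomial.X j) * G) =
      C (MvPolynomial.X j) * coeffwise (shiftOp r) G +
        ((j : (MvPolynomial ℕ ℤ)[X]) + 1) * C (MvPolynomial.X (r + j + 1)) * G := by
  induction G using polynomial_induction_C_mul_X_pow with
  | add F G hF hG => rw [mul_add, map_add, map_add, hF, hG]; ring
  | mono f c =>
    rw [← mul_assoc, ← C_mul, coeffwise_C_mul_X_pow, coeffwise_C_mul_X_pow, shiftOp_X_mul]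
    simp
    ring

/-- The sum of the `X s * X (r-1-s)` for `s < r`. -/
noncomputable def convSum (r : ℕ) : MvPolynomial ℕ ℤ :=
  ∑ s ∈ range r, MvPolynomial.X s * MvPolynomial.X (r - 1 - s)

lemma traceOp_cutSum_succ (r : ℕ) : traceOp (cutSum (r + 1)) = convSum r := by
  rw [cutSum, sum_range_succ, convSum, map_add, map_sum]
  have : r + 1 - 1 - r = 0 := by omega
  rw [this, pow_zero, mul_one, traceOp_C, add_zero]
  refine sum_congr rfl fun s hs => ?_
  have hs := mem_range.1 hs
  rw [show r + 1 - 1 - s = (r - 1 - s) + 1 by omega, traceOp_C_mul, traceOp_X_pow_succ]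

lemma cutJoinOp_X_mul (r : ℕ) (f : MvPolynomial ℕ ℤ) :
    cutJoinOp (MvPolynomial.X r * f) = MvPolynomial.X r * cutJoinOp f +
      ((r : MvPolynomial ℕ ℤ) + 1) * (2 * shiftOp r f + convSum r * f) := by
  have h : laxOp (((r : (MvPolynomial ℕ ℤ)[X]) + 1) * X ^ (r + 1) * C f) =
      ((r : (MvPolynomial ℕ ℤ)[X]) + 1) * (C f * cutSum (r + 1) + X ^ (r + 1) * laxOp (C f)) := by
    rw [show ((r : (MvPolynomial ℕ ℤ)[X]) + 1) * X ^ (r + 1) * C f =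
      (r + 1) • (X ^ (r + 1) * C f) by simp; ring, map_nsmul, laxOp_apply, joinOp_X_pow_mul,
      mul_comm _ (C f), cutOp_C_mul_X_pow, laxOp_C]
    simp
    ring
  rw [cutJoinOp_apply, C_mul, laxOp_C_X_mul, map_add, laxOp_C_X_mul, h, cutJoinOp_apply,
    shiftOp_apply, ← traceOp_X_mul, ← traceOp_cutSum_succ,
    show C (MvPolynomial.X r) * laxOp (laxOp (C f)) +
      ((r : (MvPolynomial ℕ ℤ)[X]) + 1) * X ^ (r + 1) * laxOp (C f) +
      ((r : (MvPolynomial ℕ ℤ)[X]) + 1) * (C f * cutSum (r + 1) + X ^ (r + 1) * laxOp (C f)) =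
      C (MvPolynomial.X r) * laxOp (laxOp (C f)) +
      C ((r : MvPolynomial ℕ ℤ) + 1) * (C 2 * (X * (X ^ r * laxOp (C f)))
        + C f * cutSum (r + 1)) by simp [show (C 2 : (MvPolynomial ℕ ℤ)[X]) = 2 from rfl]; ring]
  rw [map_add, traceOp_C_mul, traceOp_C_mul, map_add, traceOp_C_mul, traceOp_C_mul]
  ring

lemma cutSum_add (c r : ℕ) : cutSum (c + r + 1) =
    (∑ s ∈ range r, C (MvPolynomial.X s) * X ^ (c + r - s)) + C (MvPolynomial.X r) * X ^ c +
      ∑ s ∈ range c, C (MvPolynomial.X (r + s + 1)) * X ^ (c - 1 - s) := by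
  have h1 : ∑ s ∈ range r, (C (MvPolynomial.X s) * X ^ (r + 1 + c - 1 - s) : (MvPolynomial ℕ ℤ)[X]) =
      ∑ s ∈ range r, C (MvPolynomial.X s) * X ^ (c + r - s) :=
    sum_congr rfl fun s _ => by rw [show r + 1 + c - 1 - s = c + r - s by omega]
  have h2 : ∑ s ∈ range c, (C (MvPolynomial.X (r + 1 + s)) * X ^ (r + 1 + c - 1 - (r + 1 + s)) :
      (MvPolynomial ℕ ℤ)[X]) = ∑ s ∈ range c, C (MvPolynomial.X (r + s + 1)) * X ^ (c - 1 - s) :=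
    sum_congr rfl fun s _ => by
      rw [show r + 1 + c - 1 - (r + 1 + s) = c - 1 - s by omega, show r + 1 + s = r + s + 1 by omega]
  rw [cutSum, show c + r + 1 = (r + 1) + c by ring, sum_range_add, sum_range_succ, h1, h2,
    show r + 1 + c - 1 - r = c by omega]

lemma joinOp_markDeg (G : (MvPolynomial ℕ ℤ)[X]) (r : ℕ) :
    coeffwise (shiftOp r) (joinOp G) - joinOp (coeffwise (shiftOp r) G) +
      X ^ (r + 1) * (markDeg (joinOp G) - joinOp (markDeg G)) +
      ((r : (MvPolynomial ℕ ℤ)[X]) + 1) * X ^ (r + 1) * joinOp G = 0 := by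
  have key (f : MvPolynomial ℕ ℤ) : coeffwise (shiftOp r) (joinOp (C f)) -
      joinOp (C (shiftOp r f)) + X ^ (r + 1) * markDeg (joinOp (C f)) +
      ((r : (MvPolynomial ℕ ℤ)[X]) + 1) * X ^ (r + 1) * joinOp (C f) = 0 := by
    induction f using MvPolynomial.induction_on with
    | C a =>
      have h1 : joinOp (C (MvPolynomial.C a)) = C (MvPolynomial.C a) * X ^ 1 := by
        rw [joinOp_C, ← MvPolynomial.algebraMap_eq, Derivation.map_algebraMap]; ring
      have h2 : shiftOp r (MvPolynomial.C a) = MvPolynomial.C a * MvPolynomial.X (r + 1) := by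
        have ha : (MvPolynomial.C a : MvPolynomial ℕ ℤ) = a • 1 := by
          rw [MvPolynomial.smul_eq_C_mul, mul_one]
        rw [ha, map_smul, shiftOp_one, smul_mul_assoc, one_mul]
      have h3 : joinOp (C (MvPolynomial.C a * MvPolynomial.X (r + 1))) =
          C (MvPolynomial.X (r + 1)) * (C (MvPolynomial.C a) * X ^ 1) +
            ((r : (MvPolynomial ℕ ℤ)[X]) + 2) * X ^ (r + 2) * C (MvPolynomial.C a) := by
        rw [mul_comm, C_mul, joinOp_C_X_mul, h1]; push_cast; ring
      rw [h1, coeffwise_C_mul_X_pow, h2, h3, markDeg_C_mul, markDeg_X_pow]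
      simp
      ring
    | add f g hf hg =>
      simp only [map_add] at *
      linear_combination hf + hg
    | mul_X f j hf =>
      rw [mul_comm, shiftOp_X_mul, C_mul, joinOp_C_X_mul, map_add, coeffwise_shiftOp_C_X_mul]
      have h1 : ((j : (MvPolynomial ℕ ℤ)[X]) + 1) * X ^ (j + 1) * C f =
        (j + 1) • (X ^ (j + 1) * C f) := by simp; ring
      have h2 : joinOp (C (MvPolynomial.X j * shiftOp r f +
          ((j : MvPolynomial ℕ ℤ) + 1) * MvPolynomial.X (r + j + 1) * f)) =
          joinOp (C (MvPolynomial.X j) * C (shiftOp r f)) +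
            (j + 1) • joinOp (C (MvPolynomial.X (r + j + 1)) * C f) := by
        rw [← map_nsmul, ← map_add]; simp; ring_nf
      rw [h1, map_nsmul, coeffwise_X_pow_mul, coeffwise_C, h2, joinOp_C_X_mul, joinOp_C_X_mul,
        map_add, map_nsmul, markDeg_mul, markDeg_mul, markDeg_X_pow, ← mul_one (C (MvPolynomial.X j)),
        ← mul_one (C f), markDeg_C_mul, markDeg_C_mul, show (1 : (MvPolynomial ℕ ℤ)[X]) = X ^ 0 by simp,
        markDeg_X_pow]
      simp only [pow_zero, mul_one, nsmul_eq_mul]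
      push_cast
      linear_combination C (MvPolynomial.X j) * hf
  induction G using polynomial_induction_C_mul_X_pow with
  | add F G hF hG =>
    simp only [map_add] at *
    linear_combination hF + hG
  | mono f c =>
    have h1 : markDeg (C f * X ^ c) = c • (X ^ c * C f) := by
      rw [markDeg_C_mul, markDeg_X_pow]; simp; ring
    rw [h1, mul_comm (C f), joinOp_X_pow_mul, map_nsmul, joinOp_X_pow_mul, markDeg_mul, markDeg_X_pow,
      coeffwise_X_pow_mul, coeffwise_X_pow_mul, joinOp_X_pow_mul, coeffwise_C, nsmul_eq_mul]
    linear_combination X ^ c * key f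

lemma cutOp_markDeg (G : (MvPolynomial ℕ ℤ)[X]) (r : ℕ) :
    coeffwise (shiftOp r) (cutOp G) - cutOp (coeffwise (shiftOp r) G) +
      markDeg (cutOp (X ^ (r + 1) * G)) - X ^ (r + 1) * markDeg (cutOp G)
        + X ^ (r + 1) * markDeg (cutOp G) - cutOp (X ^ (r + 1) * markDeg G) =
      (∑ s ∈ range r, ((r - s : ℕ) : (MvPolynomial ℕ ℤ)[X]) *
        (C (MvPolynomial.X s) * X ^ (r - s))) * G := by
  induction G using polynomial_induction_C_mul_X_pow with
  | add F G hF hG =>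
    simp only [map_add, mul_add] at *
    linear_combination hF + hG
  | mono f c =>
    have h0 : X ^ (r + 1) * (C f * X ^ c) = C f * X ^ (c + r + 1) := by ring
    have h1 : X ^ (r + 1) * markDeg (C f * X ^ c) = c • (C f * X ^ (c + r + 1)) := by
      rw [markDeg_C_mul, markDeg_X_pow]; simp; ring
    have h2 : coeffwise (shiftOp r) (C f * cutSum c) = C (shiftOp r f) * cutSum c +
        C f * ∑ s ∈ range c, ((s : (MvPolynomial ℕ ℤ)[X]) + 1) *
          (C (MvPolynomial.X (r + s + 1)) * X ^ (c - 1 - s)) := by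
      rw [cutSum, mul_sum, map_sum, mul_sum, mul_sum, ← sum_add_distrib]
      refine sum_congr rfl fun s _ => ?_
      rw [show C f * (C (MvPolynomial.X s) * X ^ (c - 1 - s)) =
        C (MvPolynomial.X s) * (X ^ (c - 1 - s) * C f) by ring, coeffwise_shiftOp_C_X_mul,
        coeffwise_X_pow_mul, coeffwise_C]
      ring
    have h3 : markDeg (cutSum (c + r + 1)) - (c : (MvPolynomial ℕ ℤ)[X]) * cutSum (c + r + 1) =
        (∑ s ∈ range r, ((r - s : ℕ) : (MvPolynomial ℕ ℤ)[X]) *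
          (C (MvPolynomial.X s) * X ^ (r - s))) * X ^ c -
        ∑ s ∈ range c, ((s : (MvPolynomial ℕ ℤ)[X]) + 1) *
          (C (MvPolynomial.X (r + s + 1)) * X ^ (c - 1 - s)) := by
      rw [cutSum_add]
      simp only [map_add, map_sum, markDeg_C_mul, markDeg_X_pow, mul_add]
      have e1 : ∑ s ∈ range r, C (MvPolynomial.X s) * (((c + r - s : ℕ) : (MvPolynomial ℕ ℤ)[X]) *
            X ^ (c + r - s)) - (c : (MvPolynomial ℕ ℤ)[X]) * ∑ s ∈ range r, C (MvPolynomial.X s) * X ^ (c + r - s) =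
          (∑ s ∈ range r, ((r - s : ℕ) : (MvPolynomial ℕ ℤ)[X]) *
          (C (MvPolynomial.X s) * X ^ (r - s))) * X ^ c := by
        rw [mul_sum, ← sum_sub_distrib, sum_mul]
        refine sum_congr rfl fun s hs => ?_
        have := mem_range.1 hs
        rw [show c + r - s = (r - s) + c by omega]
        push_cast
        ring
      have e2 : ∑ s ∈ range c, C (MvPolynomial.X (r + s + 1)) *
            (((c - 1 - s : ℕ) : (MvPolynomial ℕ ℤ)[X]) * X ^ (c - 1 - s)) -
            (c : (MvPolynomial ℕ ℤ)[X]) * ∑ s ∈ range c, C (MvPolynomial.X (r + s + 1)) * X ^ (c - 1 - s) =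
          - ∑ s ∈ range c, ((s : (MvPolynomial ℕ ℤ)[X]) + 1) *
          (C (MvPolynomial.X (r + s + 1)) * X ^ (c - 1 - s)) := by
        rw [mul_sum, ← sum_sub_distrib, ← sum_neg_distrib]
        refine sum_congr rfl fun s hs => ?_
        have := mem_range.1 hs
        have h : (c : (MvPolynomial ℕ ℤ)[X]) = ((c - 1 - s : ℕ) : (MvPolynomial ℕ ℤ)[X]) + s + 1 := by
          norm_cast; omega
        rw [h]
        ring
      linear_combination e1 + e2
    rw [h0, h1, map_nsmul, cutOp_C_mul_X_pow, cutOp_C_mul_X_pow, coeffwise_C_mul_X_pow,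
      cutOp_C_mul_X_pow, h2, markDeg_C_mul, nsmul_eq_mul]
    linear_combination C f * h3

/-- The action of the cut-and-join operator on marked elements. -/
noncomputable def markedCutJoinOp : (MvPolynomial ℕ ℤ)[X] →ₗ[ℤ] (MvPolynomial ℕ ℤ)[X] :=
  coeffwise cutJoinOp + (2 : ℤ) • ((markDeg ∘ₗ cutOp).restrictScalars ℤ +
    joinOp ∘ₗ markDeg.restrictScalars ℤ)

lemma markedCutJoinOp_apply (G : (MvPolynomial ℕ ℤ)[X]) : markedCutJoinOp G =
    coeffwise cutJoinOp G + 2 * (markDeg (cutOp G) + joinOp (markDeg G)) := by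
  change coeffwise cutJoinOp G + (2 : ℤ) • (markDeg (cutOp G) + joinOp (markDeg G)) = _
  rw [zsmul_eq_mul]; rfl

lemma coeffwise_cutJoinOp_C_X_mul (r : ℕ) (G : (MvPolynomial ℕ ℤ)[X]) :
    coeffwise cutJoinOp (C (MvPolynomial.X r) * G) = C (MvPolynomial.X r) * coeffwise cutJoinOp G +
      ((r : (MvPolynomial ℕ ℤ)[X]) + 1) * (2 * coeffwise (shiftOp r) G + C (convSum r) * G) := by
  induction G using polynomial_induction_C_mul_X_pow with
  | add F G hF hG => rw [mul_add, map_add, map_add, hF, hG, map_add]; ring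
  | mono f c =>
    rw [← mul_assoc, ← C_mul, coeffwise_C_mul_X_pow, coeffwise_C_mul_X_pow, cutJoinOp_X_mul,
      coeffwise_C_mul_X_pow]
    simp only [C_add, C_mul, map_natCast, C_1, show (C 2 : (MvPolynomial ℕ ℤ)[X]) = 2 from rfl]
    ring

lemma markedCutJoinOp_C_X_mul (r : ℕ) (G : (MvPolynomial ℕ ℤ)[X]) :
    markedCutJoinOp (C (MvPolynomial.X r) * G) = C (MvPolynomial.X r) * markedCutJoinOp G +
      ((r : (MvPolynomial ℕ ℤ)[X]) + 1) * (2 * coeffwise (shiftOp r) G + C (convSum r) * G +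
        2 * (X ^ (r + 1) * markDeg G)) := by
  rw [markedCutJoinOp_apply, coeffwise_cutJoinOp_C_X_mul, cutOp_C_mul, markDeg_C_mul, markDeg_C_mul,
    joinOp_C_X_mul, markedCutJoinOp_apply]
  ring

lemma joinOp_C_convSum_mul (r : ℕ) (G : (MvPolynomial ℕ ℤ)[X]) :
    joinOp (C (convSum r) * G) = C (convSum r) * joinOp G +
      2 * (∑ s ∈ range r, ((r - s : ℕ) : (MvPolynomial ℕ ℤ)[X]) *
        (C (MvPolynomial.X s) * X ^ (r - s))) * G := by
  have h : ∀ s ∈ range r, joinOp (C (MvPolynomial.X s) * (C (MvPolynomial.X (r - 1 - s)) * G)) =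
      C (MvPolynomial.X s) * C (MvPolynomial.X (r - 1 - s)) * joinOp G +
      (((r - s : ℕ) : (MvPolynomial ℕ ℤ)[X]) * (C (MvPolynomial.X s) * X ^ (r - s)) +
      ((r - (r - 1 - s) : ℕ) : (MvPolynomial ℕ ℤ)[X]) *
        (C (MvPolynomial.X (r - 1 - s)) * X ^ (r - (r - 1 - s)))) * G := by
    intro s hs
    have := mem_range.1 hs
    rw [joinOp_C_X_mul, joinOp_C_X_mul, show r - s = (r - 1 - s) + 1 by omega,
      show r - (r - 1 - s) = s + 1 by omega]
    push_cast
    ring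
  rw [convSum, map_sum, sum_mul, map_sum]
  simp only [C_mul, mul_assoc] at h ⊢
  rw [sum_congr rfl h, sum_add_distrib, ← sum_mul, sum_add_distrib, sum_range_reflect
    (fun s => ((r - s : ℕ) : (MvPolynomial ℕ ℤ)[X]) * (C (MvPolynomial.X s) * X ^ (r - s))) r,
    sum_mul]
  simp only [mul_assoc]
  ring

lemma commute_C_X_mul (r : ℕ) (G : (MvPolynomial ℕ ℤ)[X])
    (h : markedCutJoinOp (laxOp G) = laxOp (markedCutJoinOp G)) :
    markedCutJoinOp (laxOp (C (MvPolynomial.X r) * G)) =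
      laxOp (markedCutJoinOp (C (MvPolynomial.X r) * G)) := by
  have hc (F : (MvPolynomial ℕ ℤ)[X]) : ((r : (MvPolynomial ℕ ℤ)[X]) + 1) * F = (r + 1) • F := by
    simp
  have h2 (F : (MvPolynomial ℕ ℤ)[X]) : 2 * F = 2 • F := by simp
  have e1 : markedCutJoinOp (X ^ (r + 1) * G) = X ^ (r + 1) * coeffwise cutJoinOp G +
      2 * (markDeg (cutOp (X ^ (r + 1) * G)) + X ^ (r + 1) *
        (((r : (MvPolynomial ℕ ℤ)[X]) + 1) * joinOp G + joinOp (markDeg G))) := by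
    rw [markedCutJoinOp_apply, coeffwise_X_pow_mul, markDeg_mul, markDeg_X_pow,
      show ((r + 1 : ℕ) : (MvPolynomial ℕ ℤ)[X]) * X ^ (r + 1) * G + X ^ (r + 1) * markDeg G =
        X ^ (r + 1) * ((r + 1) • G + markDeg G) by simp; ring, joinOp_X_pow_mul, map_add, map_nsmul,
        ← hc]
  have h3 (T : (MvPolynomial ℕ ℤ)[X] →ₗ[ℤ] (MvPolynomial ℕ ℤ)[X]) (F : (MvPolynomial ℕ ℤ)[X]) :
      T (((r : (MvPolynomial ℕ ℤ)[X]) + 1) * F) = ((r : (MvPolynomial ℕ ℤ)[X]) + 1) * T F := by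
    rw [hc, map_nsmul, ← hc]
  have h4 (F : (MvPolynomial ℕ ℤ)[X]) : laxOp (2 * F) = 2 * laxOp F := by
    rw [h2, map_nsmul, ← h2]
  rw [laxOp_C_X_mul, map_add, markedCutJoinOp_C_X_mul, markedCutJoinOp_C_X_mul, map_add,
    laxOp_C_X_mul, h, mul_assoc, h3, e1, h3, map_add, map_add, h4, h4]
  simp only [laxOp_apply, map_add]
  rw [joinOp_C_convSum_mul, joinOp_X_pow_mul, cutOp_C_mul, markedCutJoinOp_apply]
  linear_combination ((r : (MvPolynomial ℕ ℤ)[X]) + 1) * 2 * joinOp_markDeg G r +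
    ((r : (MvPolynomial ℕ ℤ)[X]) + 1) * 2 * cutOp_markDeg G r

lemma sum_range_triangle {M : Type*} [AddCommMonoid M] (c : ℕ) (g : ℕ → ℕ → M) :
    ∑ s ∈ range c, ∑ t ∈ range (c - 1 - s), g s t =
      ∑ u ∈ range c, ∑ s ∈ range u, g s (u - 1 - s) := by
  symm
  rw [Finset.sum_comm' (t' := range c) (s' := fun s => Ico (s + 1) c)
    (by intro x y; simp only [mem_range, mem_Ico]; omega)]
  refine sum_congr rfl fun s _ => ?_
  rw [sum_Ico_eq_sum_range, show c - (s + 1) = c - 1 - s by omega]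
  refine sum_congr rfl fun t _ => ?_
  rw [show s + 1 + t - 1 - s = t by omega]

lemma convSum_symm (u : ℕ) : ((u : MvPolynomial ℕ ℤ) + 1) * convSum u =
    2 * ∑ s ∈ range u, ((u - 1 - s : ℕ) + 1 : MvPolynomial ℕ ℤ) *
      (MvPolynomial.X s * MvPolynomial.X (u - 1 - s)) := by
  have h := sum_range_reflect (fun s => ((u - 1 - s : ℕ) + 1 : MvPolynomial ℕ ℤ) *
      (MvPolynomial.X s * MvPolynomial.X (u - 1 - s))) u
  rw [two_mul]
  nth_rewrite 1 [← h]
  rw [← sum_add_distrib, convSum, mul_sum]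
  refine sum_congr rfl fun s hs => ?_
  have := mem_range.1 hs
  rw [show u - 1 - (u - 1 - s) = s by omega,
    show (u : MvPolynomial ℕ ℤ) = ((u - 1 - s : ℕ) : MvPolynomial ℕ ℤ) + s + 1 by norm_cast; omega]
  ring

lemma markDeg_cutSum (d : ℕ) : markDeg (cutSum d) = (d : (MvPolynomial ℕ ℤ)[X]) * cutSum d -
    ∑ t ∈ range d, ((t : (MvPolynomial ℕ ℤ)[X]) + 1) *
      (C (MvPolynomial.X t) * X ^ (d - 1 - t)) := by
  rw [cutSum, map_sum, mul_sum, ← sum_sub_distrib]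
  refine sum_congr rfl fun s hs => ?_
  have := mem_range.1 hs
  rw [markDeg_C_mul, markDeg_X_pow,
    show (d : (MvPolynomial ℕ ℤ)[X]) = ((d - 1 - s : ℕ) : (MvPolynomial ℕ ℤ)[X]) + s + 1 by
      norm_cast; omega]
  ring

lemma cutJoinOp_one : cutJoinOp 1 = MvPolynomial.X 1 := by
  have h : laxOp (C 1) = C 1 * X ^ 1 := by
    rw [laxOp_C, joinOp_C, Derivation.map_one_eq_zero]; ring
  have h2 : joinOp (C 1 * X ^ 1) = X ^ (1 + 1) := by
    rw [joinOp_C_mul_X_pow, Derivation.map_one_eq_zero, C_1]; ring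
  rw [cutJoinOp_apply, h, laxOp_apply, h2, cutOp_C_mul_X_pow]
  simp only [cutSum, sum_range_one, map_add, C_1, one_mul, traceOp_X_pow_succ]
  simp [traceOp_C]

lemma markedCutJoinOp_X_pow (c : ℕ) : markedCutJoinOp (X ^ c) = C (MvPolynomial.X 1) * X ^ c +
    2 * (markDeg (cutSum c) + (c : (MvPolynomial ℕ ℤ)[X]) * X ^ (c + 1)) := by
  have h : joinOp ((c : (MvPolynomial ℕ ℤ)[X]) * X ^ c) =
      (c : (MvPolynomial ℕ ℤ)[X]) * X ^ (c + 1) := by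
    have := joinOp_C_mul_X_pow (c : MvPolynomial ℕ ℤ) c
    rw [Derivation.map_natCast] at this
    simp only [map_natCast] at this
    rw [this]; ring
  have h1 : coeffwise cutJoinOp (X ^ c) = C (MvPolynomial.X 1) * X ^ c := by
    rw [← one_mul (X ^ c), ← C_1, coeffwise_C_mul_X_pow, cutJoinOp_one, C_1, one_mul]
  rw [markedCutJoinOp_apply, h1, cutOp_X_pow, markDeg_X_pow, h]

lemma laxOp_X_pow (c : ℕ) : laxOp (X ^ c) = cutSum c + X ^ (c + 1) := by
  have := joinOp_C_mul_X_pow 1 c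
  rw [Derivation.map_one_eq_zero, C_1, one_mul] at this
  rw [laxOp_apply, cutOp_X_pow, this]
  ring

lemma natCast_mul_map (T : (MvPolynomial ℕ ℤ)[X] →ₗ[ℤ] (MvPolynomial ℕ ℤ)[X]) (n : ℕ)
    (F : (MvPolynomial ℕ ℤ)[X]) : T ((n : (MvPolynomial ℕ ℤ)[X]) * F) = n * T F := by
  rw [← nsmul_eq_mul, map_nsmul, nsmul_eq_mul]

lemma two_mul_map (T : (MvPolynomial ℕ ℤ)[X] →ₗ[ℤ] (MvPolynomial ℕ ℤ)[X])
    (F : (MvPolynomial ℕ ℤ)[X]) : T (2 * F) = 2 * T F :=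
  natCast_mul_map T 2 F

lemma convSum_triangle (c : ℕ) :
    2 * ∑ s ∈ range c, C (MvPolynomial.X s) * (((c - 1 - s : ℕ) : (MvPolynomial ℕ ℤ)[X]) *
      cutSum (c - 1 - s) - markDeg (cutSum (c - 1 - s))) =
    ∑ s ∈ range c, ((s : (MvPolynomial ℕ ℤ)[X]) + 1) * (C (convSum s) * X ^ (c - 1 - s)) := by
  have h1 : ∀ s ∈ range c, C (MvPolynomial.X s) * (((c - 1 - s : ℕ) : (MvPolynomial ℕ ℤ)[X]) *
      cutSum (c - 1 - s) - markDeg (cutSum (c - 1 - s))) = ∑ t ∈ range (c - 1 - s),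
      ((t : (MvPolynomial ℕ ℤ)[X]) + 1) * (C (MvPolynomial.X s) * C (MvPolynomial.X t)) *
        X ^ (c - 2 - s - t) := by
    intro s _
    rw [markDeg_cutSum, sub_sub_cancel, mul_sum]
    refine sum_congr rfl fun t _ => ?_
    rw [show c - 1 - s - 1 - t = c - 2 - s - t by omega]
    ring
  rw [sum_congr rfl h1, sum_range_triangle c fun s t => ((t : (MvPolynomial ℕ ℤ)[X]) + 1) *
    (C (MvPolynomial.X s) * C (MvPolynomial.X t)) * X ^ (c - 2 - s - t), mul_sum]
  refine sum_congr rfl fun u hu => ?_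
  have hu := mem_range.1 hu
  have h2 : ∀ s ∈ range u, (((u - 1 - s : ℕ) : (MvPolynomial ℕ ℤ)[X]) + 1) *
      (C (MvPolynomial.X s) * C (MvPolynomial.X (u - 1 - s))) * X ^ (c - 2 - s - (u - 1 - s)) =
      (((u - 1 - s : ℕ) : (MvPolynomial ℕ ℤ)[X]) + 1) *
      (C (MvPolynomial.X s) * C (MvPolynomial.X (u - 1 - s))) * X ^ (c - 1 - u) := by
    intro s hs
    have := mem_range.1 hs
    rw [show c - 2 - s - (u - 1 - s) = c - 1 - u by omega]
  have h3 := congrArg (C : MvPolynomial ℕ ℤ →+* (MvPolynomial ℕ ℤ)[X]) (convSum_symm u)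
  simp only [C_mul, C_add, map_natCast, C_1, map_sum,
    show (C 2 : (MvPolynomial ℕ ℤ)[X]) = 2 from rfl] at h3
  rw [sum_congr rfl h2, ← sum_mul, ← mul_assoc, ← h3]
  ring

lemma markedCutJoinOp_laxOp_X_pow (c : ℕ) :
    markedCutJoinOp (laxOp (X ^ c)) = laxOp (markedCutJoinOp (X ^ c)) := by
  have h1 : markedCutJoinOp (cutSum c) = C (MvPolynomial.X 1) * cutSum c +
      2 * ∑ s ∈ range c, C (MvPolynomial.X s) * markDeg (cutSum (c - 1 - s)) +
      2 * ∑ s ∈ range c, ((c - 1 - s : ℕ) : (MvPolynomial ℕ ℤ)[X]) *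
        (C (MvPolynomial.X s) * X ^ (c - s)) +
      2 * ∑ s ∈ range c, ((s : (MvPolynomial ℕ ℤ)[X]) + 1) *
        (C (MvPolynomial.X (s + 1)) * X ^ (c - 1 - s)) +
      ∑ s ∈ range c, ((s : (MvPolynomial ℕ ℤ)[X]) + 1) * (C (convSum s) * X ^ (c - 1 - s)) +
      2 * ∑ s ∈ range c, ((s : (MvPolynomial ℕ ℤ)[X]) + 1) *
        ((c - 1 - s : ℕ) : (MvPolynomial ℕ ℤ)[X]) * X ^ c := by
    rw [cutSum, map_sum]
    simp only [mul_sum]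
    simp only [← sum_add_distrib]
    refine sum_congr rfl fun s hs => ?_
    have := mem_range.1 hs
    have h : coeffwise (shiftOp s) (X ^ (c - 1 - s)) =
        C (MvPolynomial.X (s + 1)) * X ^ (c - 1 - s) := by
      rw [← one_mul (X ^ _), ← C_1, coeffwise_C_mul_X_pow, shiftOp_one, C_1, one_mul]
    rw [markedCutJoinOp_C_X_mul, markedCutJoinOp_X_pow, h, markDeg_X_pow,
      show c - s = c - 1 - s + 1 by omega,
      show (X ^ c : (MvPolynomial ℕ ℤ)[X]) = X ^ (s + 1) * X ^ (c - 1 - s) by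
        rw [← pow_add]; congr 1; omega]
    ring
  have h2 : laxOp (markDeg (cutSum c)) =
      ∑ s ∈ range c, C (MvPolynomial.X s) * (((c - 1 - s : ℕ) : (MvPolynomial ℕ ℤ)[X]) *
        cutSum (c - 1 - s)) +
      ∑ s ∈ range c, ((c - 1 - s : ℕ) : (MvPolynomial ℕ ℤ)[X]) *
        (C (MvPolynomial.X s) * X ^ (c - s)) +
      ∑ s ∈ range c, ((s : (MvPolynomial ℕ ℤ)[X]) + 1) *
        ((c - 1 - s : ℕ) : (MvPolynomial ℕ ℤ)[X]) * X ^ c := by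
    rw [cutSum, map_sum, map_sum, ← sum_add_distrib, ← sum_add_distrib]
    refine sum_congr rfl fun s hs => ?_
    have := mem_range.1 hs
    rw [markDeg_C_mul, markDeg_X_pow, mul_left_comm, natCast_mul_map, laxOp_C_X_mul, laxOp_X_pow,
      show c - s = c - 1 - s + 1 by omega,
      show (X ^ c : (MvPolynomial ℕ ℤ)[X]) = X ^ (s + 1) * X ^ (c - 1 - s) by
        rw [← pow_add]; congr 1; omega]
    ring
  have h3 : markDeg (cutSum (c + 1)) - (c : (MvPolynomial ℕ ℤ)[X]) * cutSum (c + 1) =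
      - ∑ s ∈ range c, ((s : (MvPolynomial ℕ ℤ)[X]) + 1) *
        (C (MvPolynomial.X (s + 1)) * X ^ (c - 1 - s)) := by
    have e : ∀ t ∈ range c, (((t + 1 : ℕ) : (MvPolynomial ℕ ℤ)[X]) + 1) *
        (C (MvPolynomial.X (t + 1)) * X ^ (c + 1 - 1 - (t + 1))) =
        ((t : (MvPolynomial ℕ ℤ)[X]) + 1) * (C (MvPolynomial.X (t + 1)) * X ^ (c - 1 - t)) +
        C (MvPolynomial.X (t + 1)) * X ^ (c + 1 - 1 - (t + 1)) := by
      intro t _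
      rw [show c + 1 - 1 - (t + 1) = c - 1 - t by omega]
      push_cast
      ring
    rw [markDeg_cutSum, sum_range_succ', sum_congr rfl e, sum_add_distrib, cutSum, sum_range_succ']
    push_cast
    ring
  have h4 := convSum_triangle c
  simp only [mul_sub, sum_sub_distrib] at h4
  rw [laxOp_X_pow, map_add, h1, markedCutJoinOp_X_pow, markedCutJoinOp_X_pow, map_add, two_mul_map,
    map_add, h2, natCast_mul_map, laxOp_C_X_mul, laxOp_X_pow, laxOp_X_pow]
  push_cast
  linear_combination 2 * h3 - h4

theorem markedCutJoinOp_laxOp (G : (MvPolynomial ℕ ℤ)[X]) :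
    markedCutJoinOp (laxOp G) = laxOp (markedCutJoinOp G) := by
  induction G using polynomial_induction_C_mul_X_pow with
  | add F G hF hG => simp only [map_add, hF, hG]
  | mono f c =>
    induction f using MvPolynomial.induction_on with
    | C a =>
      have h : (C (MvPolynomial.C a) * X ^ c : (MvPolynomial ℕ ℤ)[X]) = a • X ^ c := by
        rw [zsmul_eq_mul, show (MvPolynomial.C a : MvPolynomial ℕ ℤ) = a from eq_intCast _ a,
          map_intCast]
      rw [h]
      simp only [map_smul, markedCutJoinOp_laxOp_X_pow]
    | add f g hf hg => simp only [add_mul, map_add, hf, hg]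
    | mul_X f j hf =>
      rw [mul_comm f, C_mul, mul_assoc]
      exact commute_C_X_mul j _ hf

lemma cutJoinOp_closeOp (G : (MvPolynomial ℕ ℤ)[X]) :
    cutJoinOp (closeOp G) = closeOp (markedCutJoinOp G) + 2 * closeOp (laxOp G) := by
  induction G using polynomial_induction_C_mul_X_pow with
  | add F G hF hG => simp only [map_add, hF, hG]; ring
  | mono f c =>
    have h1 : closeOp (markDeg (cutSum c)) + closeOp (cutSum c) =
        ∑ s ∈ range c, ((c - 1 - s : ℕ) + 1 : MvPolynomial ℕ ℤ) *
          (MvPolynomial.X s * MvPolynomial.X (c - 1 - s)) := by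
      rw [cutSum, map_sum, map_sum, map_sum, ← sum_add_distrib]
      refine sum_congr rfl fun s _ => ?_
      rw [markDeg_C_mul, markDeg_X_pow, closeOp_C_mul, closeOp_C_mul, ← map_natCast C,
        closeOp_C_mul, closeOp_X_pow]
      ring
    have h2 := convSum_symm c
    have h3 : joinOp ((c : (MvPolynomial ℕ ℤ)[X]) * (C f * X ^ c)) =
        C (c : MvPolynomial ℕ ℤ) * (X ^ c * laxOp (C f)) := by
      rw [natCast_mul_map, mul_comm (C f), joinOp_X_pow_mul, laxOp_C, map_natCast]
    have h4 : joinOp (C f * X ^ c) = X ^ c * laxOp (C f) := by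
      rw [mul_comm, joinOp_X_pow_mul, laxOp_C]
    rw [closeOp_C_mul_X_pow, mul_comm f, cutJoinOp_X_mul, markedCutJoinOp_apply,
      coeffwise_C_mul_X_pow, cutOp_C_mul_X_pow, markDeg_C_mul, markDeg_C_mul, markDeg_X_pow,
      mul_left_comm (C f), h3, laxOp_apply (C f * X ^ c), cutOp_C_mul_X_pow, h4,
      show (2 : (MvPolynomial ℕ ℤ)[X]) = C 2 from rfl]
    simp only [map_add, closeOp_C_mul, closeOp_X_pow, ← shiftOp_apply]
    linear_combination f * h2 - 2 * f * h1

lemma markedCutJoinOp_C (f : MvPolynomial ℕ ℤ) :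
    markedCutJoinOp (C f) = C (cutJoinOp f) := by
  rw [markedCutJoinOp_apply, coeffwise_C, cutOp_C]
  simp [markDeg]

theorem cutJoinOp_closeOp_iterate (k : ℕ) (f : MvPolynomial ℕ ℤ) :
    cutJoinOp (closeOp (laxOp^[k] (C f))) = closeOp (laxOp^[k] (C (cutJoinOp f))) +
      2 * closeOp (laxOp^[k + 1] (C f)) := by
  have h : ∀ G, markedCutJoinOp (laxOp^[k] G) = laxOp^[k] (markedCutJoinOp G) := by
    induction k with
    | zero => intro G; rw [Function.iterate_zero, id, id]
    | succ k ih =>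
      intro G
      rw [Function.iterate_succ_apply, ih, markedCutJoinOp_laxOp, ← Function.iterate_succ_apply]
  rw [cutJoinOp_closeOp, h, markedCutJoinOp_C, Function.iterate_succ_apply']

end Operators

section PowerSeries
open MvPowerSeries

/-- The Euler derivation `x_i ∂/∂x_i` on power series. -/
noncomputable def eulerDer {N : ℕ} (i : Fin N) :
    Derivation ℚ (MvPowerSeries (Fin N) ℚ) (MvPowerSeries (Fin N) ℚ) :=
  (X i : MvPowerSeries (Fin N) ℚ) • pderiv ℚ i

lemma coeff_X_mul_eq_ite {N : ℕ} (i : Fin N) (F : MvPowerSeries (Fin N) ℚ) (l : Fin N →₀ ℕ) :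
    coeff l (X i * F) = if 0 < l i then coeff (l - Finsupp.single i 1) F else 0 := by
  rw [X_def, coeff_monomial_mul]
  simp [Nat.one_le_iff_ne_zero, Nat.pos_iff_ne_zero]

lemma coeff_eulerDer {N : ℕ} (i : Fin N) (F : MvPowerSeries (Fin N) ℚ) (l : Fin N →₀ ℕ) :
    coeff l (eulerDer i F) = l i * coeff l F := by
  rw [eulerDer, Derivation.smul_apply, smul_eq_mul, coeff_X_mul_eq_ite]
  split_ifs with h
  · have hl : l - Finsupp.single i 1 + Finsupp.single i 1 = l :=
      tsub_add_cancel_of_le (by rw [Finsupp.single_le_iff]; exact h)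
    rw [coeff_pderiv, hl, Finsupp.tsub_apply, Finsupp.single_eq_same, Nat.cast_sub h]
    push_cast
    ring
  · rw [Nat.eq_zero_of_not_pos h]; simp

lemma eulerDer_X {N : ℕ} (i j : Fin N) :
    eulerDer i (X j) = if i = j then (X j : MvPowerSeries (Fin N) ℚ) else 0 := by
  rw [eulerDer, Derivation.smul_apply, smul_eq_mul]
  split_ifs with h
  · rw [h, pderiv_X_self, mul_one]
  · rw [pderiv_X_of_ne (Ne.symm h), mul_zero]

lemma Derivation.map_prod_of_map_eq_mul {A ι : Type*} [CommRing A] [Algebra ℚ A]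
    (D : Derivation ℚ A A) (s : Finset ι) (F h : ι → A) (hF : ∀ i ∈ s, D (F i) = F i * h i) :
    D (∏ i ∈ s, F i) = (∏ i ∈ s, F i) * ∑ i ∈ s, h i := by
  classical
  induction s using Finset.induction_on with
  | empty => simp
  | insert a s ha ih =>
    rw [prod_insert ha, sum_insert ha, Derivation.leibniz, hF a (mem_insert_self a s),
      ih fun i hi => hF i (mem_insert_of_mem hi)]
    simp only [smul_eq_mul]
    ring

lemma Derivation.map_pow_of_map_eq_mul {A : Type*} [CommRing A] [Algebra ℚ A]
    (D : Derivation ℚ A A) (m : ℕ) (F h : A) (hF : D F = F * h) :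
    D (F ^ m) = F ^ m * (m * h) := by
  have := D.map_prod_of_map_eq_mul (range m) (fun _ => F) (fun _ => h) fun _ _ => hF
  simpa using this

lemma eulerDer_X_pow {N : ℕ} (i j : Fin N) (m : ℕ) :
    eulerDer i (X j ^ m) = if i = j then (m : MvPowerSeries (Fin N) ℚ) * X j ^ m else 0 := by
  rw [Derivation.map_pow_of_map_eq_mul _ _ _ (if i = j then 1 else 0) (by simp [eulerDer_X])]
  split_ifs <;> ring

/-- The exponential power series `exp (x_1 + ⋯ + x_N)`. -/
noncomputable def expSeries (N : ℕ) : MvPowerSeries (Fin N) ℚ :=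
  fun l => ∏ i, ((l i).factorial : ℚ)⁻¹

lemma coeff_expSeries {N : ℕ} (l : Fin N →₀ ℕ) :
    coeff l (expSeries N) = ∏ i, ((l i).factorial : ℚ)⁻¹ := rfl

lemma eulerDer_expSeries {N : ℕ} (i : Fin N) :
    eulerDer i (expSeries N) = X i * expSeries N := by
  ext l
  rw [coeff_eulerDer, coeff_X_mul_eq_ite, coeff_expSeries]
  split_ifs with h
  · rw [coeff_expSeries, ← mul_prod_erase _ _ (mem_univ i), ← mul_prod_erase _ _ (mem_univ i),
      ← mul_assoc]
    congr 1
    · rw [Finsupp.tsub_apply, Finsupp.single_eq_same, ← Nat.mul_factorial_pred h.ne']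
      have : (l i : ℚ) ≠ 0 := by exact_mod_cast h.ne'
      push_cast
      field_simp
    · refine prod_congr rfl fun j hj => ?_
      rw [Finsupp.tsub_apply, Finsupp.single_eq_of_ne (ne_of_mem_erase hj), tsub_zero]
  · rw [Nat.eq_zero_of_not_pos h]; simp

/-- Evaluation of abstract power sums, `X r ↦ p_{r+1}`, as power series in `N` variables. -/
noncomputable def psEval (N : ℕ) : MvPolynomial ℕ ℤ →ₐ[ℤ] MvPowerSeries (Fin N) ℚ :=
  MvPolynomial.aeval fun r => ∑ i, X i ^ (r + 1)

lemma psEval_X (N r : ℕ) : psEval N (MvPolynomial.X r) = ∑ i, X i ^ (r + 1) :=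
  MvPolynomial.aeval_X _ _

/-- Evaluation of abstract power sums, with the marked variable sent to `x_i`. -/
noncomputable def psEvalMark {N : ℕ} (i : Fin N) :
    Polynomial (MvPolynomial ℕ ℤ) →+* MvPowerSeries (Fin N) ℚ :=
  Polynomial.eval₂RingHom (psEval N : MvPolynomial ℕ ℤ →+* MvPowerSeries (Fin N) ℚ) (X i)

lemma psEvalMark_C {N : ℕ} (i : Fin N) (f : MvPolynomial ℕ ℤ) :
    psEvalMark i (Polynomial.C f) = psEval N f := by
  simp [psEvalMark]

lemma psEvalMark_X {N : ℕ} (i : Fin N) : psEvalMark i Polynomial.X = X i := by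
  simp [psEvalMark]

lemma eulerDer_psEval {N : ℕ} (i : Fin N) (f : MvPolynomial ℕ ℤ) :
    eulerDer i (psEval N f) = psEvalMark i (joinDer f) := by
  induction f using MvPolynomial.induction_on with
  | C a => 
    rw [← MvPolynomial.algebraMap_eq, AlgHom.commutes, Derivation.map_algebraMap, map_zero,
      eq_intCast, Derivation.map_intCast]
  | add f g hf hg => simp only [map_add, hf, hg]
  | mul_X f j hf =>
    have h : eulerDer i (psEval N (MvPolynomial.X j)) =
        ((j : MvPowerSeries (Fin N) ℚ) + 1) * X i ^ (j + 1) := by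
      rw [psEval_X, map_sum]
      simp only [eulerDer_X_pow]
      simp
    rw [map_mul, Derivation.leibniz, h, hf, mul_comm f, joinDer_X_mul]
    simp only [map_add, map_mul, map_pow, psEvalMark_C, psEvalMark_X, map_natCast, map_one,
      smul_eq_mul]
    ring

lemma eulerDer_psEvalMark {N : ℕ} (i : Fin N) (G : Polynomial (MvPolynomial ℕ ℤ)) :
    eulerDer i (psEvalMark i G) =
      psEvalMark i (markDeg G + joinOp G) - X i * psEvalMark i G := by
  induction G using polynomial_induction_C_mul_X_pow with
  | add F G hF hG => simp only [map_add, hF, hG]; ring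
  | mono f c =>
    rw [markDeg_C_mul, markDeg_X_pow, joinOp_C_mul_X_pow]
    simp only [map_add, map_mul, map_pow, psEvalMark_C, psEvalMark_X, map_natCast,
      Derivation.leibniz, eulerDer_X_pow, eulerDer_psEval, smul_eq_mul, if_true]
    ring

lemma sum_psEvalMark_X_mul {N : ℕ} (H : Polynomial (MvPolynomial ℕ ℤ)) :
    ∑ i : Fin N, X i * psEvalMark i H = psEval N (closeOp H) := by
  induction H using polynomial_induction_C_mul_X_pow with
  | add F G hF hG => simp only [map_add, mul_add, sum_add_distrib, hF, hG]
  | mono f c =>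
    rw [closeOp_C_mul_X_pow, map_mul, psEval_X, mul_sum]
    refine sum_congr rfl fun i _ => ?_
    simp only [map_mul, map_pow, psEvalMark_C, psEvalMark_X]
    ring

/-- The Vandermonde product as a power series. -/
noncomputable def vdmSeries (N : ℕ) : MvPowerSeries (Fin N) ℚ :=
  ∏ i : Fin N, ∏ j ∈ Ioi i, (X i - X j)

lemma vdmSeries_eq_sum (N : ℕ) : vdmSeries N =
    ∑ s : Perm (Fin N), (Perm.sign s : ℤ) • ∏ i : Fin N, (-X (s i)) ^ (i : ℕ) := by
  have h := Matrix.det_vandermonde fun i : Fin N => (-X i : MvPowerSeries (Fin N) ℚ)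
  rw [Matrix.det_apply] at h
  rw [vdmSeries]
  simp only [Matrix.vandermonde_apply, neg_sub_neg, Units.smul_def] at h
  exact h.symm

lemma eulerDer_monomial {N : ℕ} (s : Perm (Fin N)) (j : Fin N) :
    eulerDer j (∏ i : Fin N, (-X (s i) : MvPowerSeries (Fin N) ℚ) ^ (i : ℕ)) =
      (∏ i : Fin N, (-X (s i) : MvPowerSeries (Fin N) ℚ) ^ (i : ℕ)) * ((s⁻¹ j : ℕ) : MvPowerSeries (Fin N) ℚ) := by
  rw [Derivation.map_prod_of_map_eq_mul _ _ _
    fun i : Fin N => ((i : ℕ) : MvPowerSeries (Fin N) ℚ) * if j = s i then 1 else 0]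
  · congr 1
    rw [sum_eq_single (s⁻¹ j)]
    · simp
    · intro b _ hb
      rw [if_neg, mul_zero]
      rintro rfl
      simp at hb
    · simp
  · intro i _
    refine Derivation.map_pow_of_map_eq_mul _ _ _ _ ?_
    rw [map_neg, eulerDer_X]
    split_ifs <;> simp

lemma sum_eulerDer_vdmSeries (N : ℕ) : ∑ j, eulerDer j (vdmSeries N) =
    (∑ i : Fin N, ((i : ℕ) : MvPowerSeries (Fin N) ℚ)) * vdmSeries N := by
  rw [vdmSeries_eq_sum, mul_sum]
  simp only [map_sum]
  rw [sum_comm]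
  refine sum_congr rfl fun s _ => ?_
  simp only [map_zsmul, eulerDer_monomial]
  rw [← smul_sum, ← mul_sum, Equiv.sum_comp s⁻¹ fun j => ((j : ℕ) : MvPowerSeries (Fin N) ℚ),
    mul_comm, mul_smul_comm]

lemma sum_eulerDer_eulerDer_vdmSeries (N : ℕ) : ∑ j, eulerDer j (eulerDer j (vdmSeries N)) =
    (∑ i : Fin N, ((i : ℕ) : MvPowerSeries (Fin N) ℚ) ^ 2) * vdmSeries N := by
  rw [vdmSeries_eq_sum, mul_sum]
  simp only [map_sum]
  rw [sum_comm]
  refine sum_congr rfl fun s _ => ?_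
  simp only [map_zsmul, eulerDer_monomial, Derivation.leibniz, Derivation.map_natCast,
    smul_eq_mul, mul_zero, zero_add]
  rw [← Equiv.sum_comp s⁻¹ fun j => ((j : ℕ) : MvPowerSeries (Fin N) ℚ) ^ 2, sum_mul]
  refine sum_congr rfl fun i _ => ?_
  rw [mul_smul_comm]
  congr 1
  ring

lemma sum_ordered_pairs {N : ℕ} {M : Type*} [AddCommGroup M] (h : Fin N → Fin N → M)
    (hs : ∀ i j, h i j = h j i) :
    (2 : ℕ) • ∑ i, ∑ j ∈ Ioi i, h i j = ∑ i, ∑ j, h i j - ∑ i, h i i := by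
  have h1 : ∑ i, ∑ j ∈ Ioi i, h i j = ∑ i, ∑ j ∈ Iio i, h i j := by
    rw [Finset.sum_comm' (t' := univ) (s' := fun j => Iio j) (by simp)]
    exact sum_congr rfl fun i _ => sum_congr rfl fun j _ => hs _ _
  have h2 : ∀ i, ∑ j, h i j = ∑ j ∈ Ioi i, h i j + ∑ j ∈ Iio i, h i j + h i i := by
    intro i
    rw [← sum_filter_add_sum_filter_not univ (fun j => i < j), add_assoc]
    congr 1
    · exact sum_congr (by ext; simp) fun _ _ => rfl
    · rw [← sum_filter_add_sum_filter_not _ (fun j => j < i)]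
      congr 1
      · refine sum_congr ?_ fun _ _ => rfl
        ext j; simp only [mem_filter, mem_univ, mem_Iio, true_and]; omega
      · rw [← sum_singleton (fun j => h i j) i]
        refine sum_congr ?_ fun _ _ => rfl
        ext j; simp only [mem_filter, mem_univ, mem_singleton, true_and]; omega
  rw [sum_congr rfl fun i _ => h2 i, sum_add_distrib, sum_add_distrib, add_sub_cancel_right, ← h1,
    two_nsmul]

lemma two_mul_sum_X_pow_mul_eulerDer_vdmSeries (N c : ℕ) :
    2 * ∑ i, X i ^ (c + 1) * eulerDer i (vdmSeries N) = vdmSeries N *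
      (∑ t ∈ range (c + 2), (∑ i : Fin N, X i ^ t) * (∑ i : Fin N, X i ^ (c + 1 - t)) -
        ((c : MvPowerSeries (Fin N) ℚ) + 2) * ∑ i : Fin N, X i ^ (c + 1)) := by
  let D : Derivation ℚ (MvPowerSeries (Fin N) ℚ) (MvPowerSeries (Fin N) ℚ) :=
    ∑ i, (X i ^ (c + 1) : MvPowerSeries (Fin N) ℚ) • eulerDer i
  have hD (F) : D F = ∑ i, X i ^ (c + 1) * eulerDer i F := by
    rw [show D F = Derivation.coeFnAddMonoidHom D F from rfl, map_sum, Finset.sum_apply]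
    rfl
  have hX (j : Fin N) : D (X j) = X j ^ (c + 2) := by
    rw [hD]
    simp [eulerDer_X]
    ring
  let h (i j : Fin N) : MvPowerSeries (Fin N) ℚ := ∑ t ∈ range (c + 2), X i ^ t * X j ^ (c + 1 - t)
  have hh (i j : Fin N) : D (X i - X j) = (X i - X j) * h i j := by
    rw [map_sub, hX, hX, mul_comm, ← Commute.geom_sum₂_mul (Commute.all _ _)]
    rfl
  have hs (i j : Fin N) : h i j = h j i := by
    simp only [h]
    rw [← sum_range_reflect]
    refine sum_congr rfl fun t ht => ?_
    have := mem_range.1 ht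
    rw [show c + 2 - 1 - t = c + 1 - t by omega, show c + 1 - (c + 1 - t) = t by omega, mul_comm]
  have key : D (vdmSeries N) = vdmSeries N * ∑ i, ∑ j ∈ Ioi i, h i j := by
    rw [vdmSeries]
    exact D.map_prod_of_map_eq_mul _ _ _ fun i _ => D.map_prod_of_map_eq_mul _ _ _ fun j _ => hh i j
  have hdiag (i : Fin N) : h i i = ((c : MvPowerSeries (Fin N) ℚ) + 2) * X i ^ (c + 1) := by
    simp only [h]
    rw [sum_congr rfl fun t ht => show (X i ^ t * X i ^ (c + 1 - t) : MvPowerSeries (Fin N) ℚ) =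
      X i ^ (c + 1) by
        have := mem_range.1 ht
        rw [← pow_add]; congr 1; omega]
    simp
  rw [← hD, key, mul_left_comm]
  congr 1
  have := sum_ordered_pairs h hs
  rw [nsmul_eq_mul] at this
  rw [show (2 : MvPowerSeries (Fin N) ℚ) = ((2 : ℕ) : MvPowerSeries (Fin N) ℚ) from rfl, this,
    sum_congr rfl fun i _ => hdiag i, ← mul_sum]
  congr 1
  simp only [h, sum_mul_sum]
  exact (sum_congr rfl fun i _ => sum_comm).trans sum_comm

lemma closeOp_cutSum (c : ℕ) : closeOp (cutSum c) = convSum c := by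
  rw [cutSum, map_sum, convSum]
  exact sum_congr rfl fun s _ => by rw [closeOp_C_mul_X_pow]; 

lemma traceOp_cutOp_X_mul (H : Polynomial (MvPolynomial ℕ ℤ)) :
    traceOp (cutOp (Polynomial.X * H)) = closeOp (cutOp H) := by
  induction H using polynomial_induction_C_mul_X_pow with
  | add F G hF hG => simp only [map_add, mul_add, hF, hG]
  | mono f c =>
    rw [mul_left_comm, ← pow_succ', cutOp_C_mul_X_pow, cutOp_C_mul_X_pow, traceOp_C_mul,
      closeOp_C_mul, traceOp_cutSum_succ, closeOp_cutSum]

lemma exists_joinOp_C_eq_X_mul (f : MvPolynomial ℕ ℤ) :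
    ∃ H, joinOp (Polynomial.C f) = Polynomial.X * H := by
  induction f using MvPolynomial.induction_on with
  | C a =>
    refine ⟨Polynomial.C (MvPolynomial.C a), ?_⟩
    rw [joinOp_C, ← MvPolynomial.algebraMap_eq, Derivation.map_algebraMap, zero_add]
  | add f g hf hg =>
    obtain ⟨F, hF⟩ := hf
    obtain ⟨G, hG⟩ := hg
    exact ⟨F + G, by rw [Polynomial.C_add, map_add, hF, hG, mul_add]⟩
  | mul_X f j hf =>
    obtain ⟨F, hF⟩ := hf
    refine ⟨Polynomial.C (MvPolynomial.X j) * F +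
      ((j : Polynomial (MvPolynomial ℕ ℤ)) + 1) * Polynomial.X ^ j * Polynomial.C f, ?_⟩
    rw [mul_comm, Polynomial.C_mul, joinOp_C_X_mul, hF]
    ring

lemma two_mul_sum_eulerDer_vdmSeries_mul (N : ℕ) (H : Polynomial (MvPolynomial ℕ ℤ)) :
    2 * ∑ i, eulerDer i (vdmSeries N) * (X i * psEvalMark i H) = vdmSeries N *
      ((2 * (N : MvPowerSeries (Fin N) ℚ) - 2) * psEval N (closeOp H) +
        psEval N (closeOp (cutOp H)) - psEval N (closeOp (markDeg H))) := by
  induction H using polynomial_induction_C_mul_X_pow with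
  | add F G hF hG =>
    simp only [map_add, mul_add, sum_add_distrib] at *
    linear_combination hF + hG
  | mono f c =>
    have h := two_mul_sum_X_pow_mul_eulerDer_vdmSeries N c
    have h1 : ∑ i, eulerDer i (vdmSeries N) * (X i * psEvalMark i (Polynomial.C f * Polynomial.X ^ c)) =
        psEval N f * ∑ i, X i ^ (c + 1) * eulerDer i (vdmSeries N) := by
      rw [mul_sum]
      refine sum_congr rfl fun i _ => ?_
      simp only [map_mul, map_pow, psEvalMark_C, psEvalMark_X]
      ring
    have h2 : ∑ t ∈ range (c + 2), (∑ i : Fin N, X i ^ t : MvPowerSeries (Fin N) ℚ) *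
        (∑ i : Fin N, X i ^ (c + 1 - t)) =
        psEval N (convSum c) + 2 * N * psEval N (MvPolynomial.X c) := by
      rw [sum_range_succ, sum_range_succ', convSum, map_sum, psEval_X]
      have h3 : ∀ t ∈ range c, (∑ i : Fin N, X i ^ (t + 1) : MvPowerSeries (Fin N) ℚ) *
          (∑ i : Fin N, X i ^ (c + 1 - (t + 1))) =
          psEval N (MvPolynomial.X t * MvPolynomial.X (c - 1 - t)) := by
        intro t ht
        have := mem_range.1 ht
        rw [map_mul, psEval_X, psEval_X, show c + 1 - (t + 1) = c - 1 - t + 1 by omega]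
      rw [sum_congr rfl h3]
      simp
      ring
    have h4 : closeOp ((c : Polynomial (MvPolynomial ℕ ℤ)) * Polynomial.X ^ c) =
        (c : MvPolynomial ℕ ℤ) * MvPolynomial.X c := by
      rw [← map_natCast Polynomial.C, closeOp_C_mul_X_pow]
    rw [h1, mul_left_comm, h, h2, closeOp_C_mul_X_pow, cutOp_C_mul_X_pow, closeOp_C_mul,
      closeOp_cutSum, markDeg_C_mul, markDeg_X_pow, closeOp_C_mul, h4, ← psEval_X]
    simp only [map_mul, map_natCast]
    ring

lemma cutJoinOp_eq_of_joinOp_C {f : MvPolynomial ℕ ℤ} {H : Polynomial (MvPolynomial ℕ ℤ)}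
    (hH : joinOp (Polynomial.C f) = Polynomial.X * H) :
    cutJoinOp f = closeOp (cutOp H) + closeOp (joinOp H) := by
  have := joinOp_X_pow_mul 1 H
  rw [pow_one] at this
  rw [cutJoinOp_apply, laxOp_C, hH, laxOp_apply, map_add, traceOp_cutOp_X_mul, this, traceOp_X_mul]

/-- The product of the Vandermonde product and the exponential series. -/
noncomputable def dimSeries (N : ℕ) : MvPowerSeries (Fin N) ℚ := vdmSeries N * expSeries N

lemma sum_eulerDer_dimSeries_mul (N : ℕ) (f : MvPolynomial ℕ ℤ) :
    ∑ i, eulerDer i (eulerDer i (dimSeries N * psEval N f)) -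
      (2 * (N : MvPowerSeries (Fin N) ℚ) - 1) * ∑ i, eulerDer i (dimSeries N * psEval N f) =
    dimSeries N * psEval N (cutJoinOp f) +
      ((∑ i : Fin N, ((i : ℕ) : MvPowerSeries (Fin N) ℚ) ^ 2) -
        (2 * (N : MvPowerSeries (Fin N) ℚ) - 1) * ∑ i : Fin N, ((i : ℕ) : MvPowerSeries (Fin N) ℚ)) *
        (dimSeries N * psEval N f) := by
  obtain ⟨H, hH⟩ := exists_joinOp_C_eq_X_mul f
  have hf (i : Fin N) : eulerDer i (psEval N f) = X i * psEvalMark i H - X i * psEval N f := by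
    have h := congrArg (psEvalMark i) hH
    rw [joinOp_C] at h
    simp only [map_add, map_mul, psEvalMark_C, psEvalMark_X] at h
    rw [eulerDer_psEval]
    linear_combination h
  have hX (i : Fin N) : eulerDer i (X i * psEvalMark i H) =
      X i * psEvalMark i (H + markDeg H + joinOp H) - X i * (X i * psEvalMark i H) := by
    have h1 := joinOp_X_pow_mul 1 H
    have h2 := markDeg_X_pow 1
    rw [pow_one] at h1 h2
    rw [← psEvalMark_X, ← map_mul, eulerDer_psEvalMark, h1, markDeg_mul, h2, psEvalMark_X]
    simp only [map_add, map_mul, psEvalMark_X, map_natCast]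
    push_cast
    ring
  have h1 (i : Fin N) : eulerDer i (dimSeries N * psEval N f) =
      expSeries N * psEval N f * eulerDer i (vdmSeries N) +
      vdmSeries N * expSeries N * (X i * psEvalMark i H) := by
    simp only [dimSeries, Derivation.leibniz, hf, eulerDer_expSeries, smul_eq_mul]
    ring
  have h2 (i : Fin N) : eulerDer i (eulerDer i (dimSeries N * psEval N f)) =
      expSeries N * (2 * (eulerDer i (vdmSeries N) * (X i * psEvalMark i H))) +
      expSeries N * psEval N f * eulerDer i (eulerDer i (vdmSeries N)) +
      vdmSeries N * expSeries N * (X i * psEvalMark i (H + markDeg H + joinOp H)) := by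
    rw [h1, map_add, Derivation.leibniz, Derivation.leibniz _ (_ * expSeries N), hX]
    simp only [Derivation.leibniz, hf, eulerDer_expSeries, smul_eq_mul]
    ring
  rw [sum_congr rfl fun i _ => h2 i, sum_congr rfl fun i _ => h1 i]
  simp only [sum_add_distrib, ← mul_sum, sum_psEvalMark_X_mul, sum_eulerDer_vdmSeries,
    sum_eulerDer_eulerDer_vdmSeries, two_mul_sum_eulerDer_vdmSeries_mul,
    cutJoinOp_eq_of_joinOp_C hH]
  simp only [map_add, dimSeries]
  ring

lemma coeff_natCast_mul {N : ℕ} (l : Fin N →₀ ℕ) (n : ℕ) (F : MvPowerSeries (Fin N) ℚ) :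
    coeff l ((n : MvPowerSeries (Fin N) ℚ) * F) = n * coeff l F := by
  rw [← nsmul_eq_mul, map_nsmul, nsmul_eq_mul]

/-- The eigenvalue of `cutJoinOp` at the exponent vector `l`: a quadratic form in the entries of
`l`, twice the sum of the contents of the partition when `l` comes from one. -/
def contentForm {N : ℕ} (l : Fin N →₀ ℕ) : ℚ :=
  ∑ i, (l i : ℚ) ^ 2 - (2 * N - 1) * ∑ i, (l i : ℚ) -
    (∑ i : Fin N, ((i : ℕ) : ℚ) ^ 2 - (2 * N - 1) * ∑ i : Fin N, ((i : ℕ) : ℚ))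

lemma coeff_dimSeries_mul_cutJoinOp {N : ℕ} (l : Fin N →₀ ℕ) (f : MvPolynomial ℕ ℤ) :
    coeff l (dimSeries N * psEval N (cutJoinOp f)) =
      contentForm l * coeff l (dimSeries N * psEval N f) := by
  have h := congrArg (coeff l) (sum_eulerDer_dimSeries_mul N f)
  set F := dimSeries N * psEval N f
  have e1 : (2 * (N : MvPowerSeries (Fin N) ℚ) - 1) * ∑ i, eulerDer i F =
      ((2 * N : ℕ) : MvPowerSeries (Fin N) ℚ) * ∑ i, eulerDer i F - ∑ i, eulerDer i F := by
    push_cast; ring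
  have e2 : ((∑ i : Fin N, ((i : ℕ) : MvPowerSeries (Fin N) ℚ) ^ 2) -
        (2 * (N : MvPowerSeries (Fin N) ℚ) - 1) * ∑ i : Fin N, ((i : ℕ) : MvPowerSeries (Fin N) ℚ)) * F
      = ((∑ i : Fin N, (i : ℕ) ^ 2 + ∑ i : Fin N, (i : ℕ) : ℕ) : MvPowerSeries (Fin N) ℚ) * F -
      ((2 * N * ∑ i : Fin N, (i : ℕ) : ℕ) : MvPowerSeries (Fin N) ℚ) * F := by
    push_cast; ring
  rw [e1, e2] at h
  simp only [map_sub, map_add, map_sum, coeff_natCast_mul, coeff_eulerDer] at h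
  push_cast at h
  rw [contentForm]
  have e3 : ∑ i, (l i : ℚ) * ((l i : ℚ) * coeff l F) = (∑ i, (l i : ℚ) ^ 2) * coeff l F := by
    rw [sum_mul]
    exact sum_congr rfl fun i _ => by ring
  rw [e3, ← sum_mul] at h
  linear_combination -h

lemma sum_tsub_single {N : ℕ} (φ : ℕ → ℚ) (l : Fin N →₀ ℕ) (i : Fin N) :
    ∑ j, φ ((l - Finsupp.single i 1 : Fin N →₀ ℕ) j) = ∑ j, φ (l j) - φ (l i) + φ (l i - 1) := by
  rw [← add_sum_erase _ _ (mem_univ i), ← add_sum_erase _ (fun j => φ (l j)) (mem_univ i),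
    Finsupp.tsub_apply, Finsupp.single_eq_same]
  rw [sum_congr rfl fun j hj => show φ ((l - Finsupp.single i 1 : Fin N →₀ ℕ) j) = φ (l j) by
    rw [Finsupp.tsub_apply, Finsupp.single_eq_of_ne (ne_of_mem_erase hj), tsub_zero]]
  ring

lemma contentForm_tsub_single {N : ℕ} (l : Fin N →₀ ℕ) (i : Fin N) (h : 0 < l i) :
    contentForm (l - Finsupp.single i 1) = contentForm l - 2 * ((l i : ℚ) - N) := by
  rw [contentForm, contentForm, sum_tsub_single (fun x => (x : ℚ) ^ 2),
    sum_tsub_single (fun x => (x : ℚ)), Nat.cast_sub h]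
  push_cast
  ring

lemma coeff_dimSeries_mul_closeOp_iterate {N : ℕ} (k : ℕ) (f : MvPolynomial ℕ ℤ)
    (l : Fin N →₀ ℕ) :
    coeff l (dimSeries N * psEval N (closeOp (laxOp^[k] (Polynomial.C f)))) =
      ∑ i, ((l i : ℚ) - N) ^ k * coeff l (X i * (dimSeries N * psEval N f)) := by
  induction k generalizing f with
  | zero =>
    have h : closeOp (Polynomial.C f) = f * MvPolynomial.X 0 := by
      rw [← closeOp_C_mul_X_pow, pow_zero, mul_one]
    rw [Function.iterate_zero_apply, h, map_mul (psEval N), psEval_X]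
    simp only [zero_add, pow_one, pow_zero, one_mul, ← map_sum, ← sum_mul]
    congr 1
    ring
  | succ k ih =>
    have h := congrArg (fun g => coeff l (dimSeries N * psEval N g)) (cutJoinOp_closeOp_iterate k f)
    simp only [coeff_dimSeries_mul_cutJoinOp, map_add, mul_add, map_mul (psEval N), ih] at h
    have h2 : coeff l (dimSeries N * (psEval N 2 *
        psEval N (closeOp (laxOp^[k + 1] (Polynomial.C f))))) =
        2 * coeff l (dimSeries N * psEval N (closeOp (laxOp^[k + 1] (Polynomial.C f)))) := by
      have := coeff_natCast_mul l 2
        (dimSeries N * psEval N (closeOp (laxOp^[k + 1] (Polynomial.C f))))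
      rw [map_ofNat, mul_left_comm]
      exact_mod_cast this
    rw [h2] at h
    have h3 (i : Fin N) : coeff l (X i * (dimSeries N * psEval N (cutJoinOp f))) =
        (contentForm l - 2 * ((l i : ℚ) - N)) * coeff l (X i * (dimSeries N * psEval N f)) := by
      rw [coeff_X_mul_eq_ite, coeff_X_mul_eq_ite]
      split_ifs with hi
      · rw [coeff_dimSeries_mul_cutJoinOp, contentForm_tsub_single l i hi]
      · rw [mul_zero]
    have h4 : ∑ i, ((l i : ℚ) - N) ^ k * coeff l (X i * (dimSeries N * psEval N (cutJoinOp f))) =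
        contentForm l * ∑ i, ((l i : ℚ) - N) ^ k * coeff l (X i * (dimSeries N * psEval N f)) -
        2 * ∑ i, ((l i : ℚ) - N) ^ (k + 1) * coeff l (X i * (dimSeries N * psEval N f)) := by
      rw [mul_sum, mul_sum, ← sum_sub_distrib]
      refine sum_congr rfl fun i _ => ?_
      rw [h3]
      ring
    rw [h4] at h
    linear_combination -h / 2

end PowerSeries

section Filtration
open Polynomial

/-- Sums of monomials of weight at most `d`, where `X r` has weight `r + 1`. -/
inductive WeightLE : ℕ → MvPolynomial ℕ ℤ → Prop
  | const (d : ℕ) (a : ℤ) : WeightLE d (MvPolynomial.C a)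
  | add {d : ℕ} {f g : MvPolynomial ℕ ℤ} : WeightLE d f → WeightLE d g → WeightLE d (f + g)
  | X_mul {d e : ℕ} (r : ℕ) {f : MvPolynomial ℕ ℤ} :
      WeightLE e f → e + r + 1 ≤ d → WeightLE d (MvPolynomial.X r * f)

lemma WeightLE.mono {d e : ℕ} {f : MvPolynomial ℕ ℤ} (h : WeightLE d f) (hde : d ≤ e) :
    WeightLE e f := by
  induction h with
  | const d a => exact .const e a
  | add _ _ hf hg => exact (hf hde).add (hg hde)
  | X_mul r h hle => exact h.X_mul r (hle.trans hde)

lemma exists_weightLE (f : MvPolynomial ℕ ℤ) : ∃ d, WeightLE d f := by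
  induction f using MvPolynomial.induction_on with
  | C a => exact ⟨0, .const 0 a⟩
  | add f g hf hg =>
    obtain ⟨d, hd⟩ := hf
    obtain ⟨e, he⟩ := hg
    exact ⟨max d e, (hd.mono (le_max_left d e)).add (he.mono (le_max_right d e))⟩
  | mul_X f r hf =>
    obtain ⟨d, hd⟩ := hf
    exact ⟨d + r + 1, by rw [mul_comm]; exact hd.X_mul r le_rfl⟩

lemma WeightLE.nsmul {d : ℕ} {f : MvPolynomial ℕ ℤ} (h : WeightLE d f) (n : ℕ) :
    WeightLE d (n • f) := by
  induction n with
  | zero => simpa using WeightLE.const d 0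
  | succ n ih => rw [succ_nsmul]; exact ih.add h

/-- Sums of marked monomials of weight less than `d`, where the marked variable has weight `1`. -/
inductive MarkedWeightLT (d : ℕ) : (MvPolynomial ℕ ℤ)[X] → Prop
  | zero : MarkedWeightLT d 0
  | add {F G : (MvPolynomial ℕ ℤ)[X]} :
      MarkedWeightLT d F → MarkedWeightLT d G → MarkedWeightLT d (F + G)
  | C_mul_X_pow {e c : ℕ} {f : MvPolynomial ℕ ℤ} :
      WeightLE e f → e + c < d → MarkedWeightLT d (C f * X ^ c)

namespace MarkedWeightLT

variable {d e : ℕ} {F G : (MvPolynomial ℕ ℤ)[X]}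

lemma mono (h : MarkedWeightLT d G) (hde : d ≤ e) : MarkedWeightLT e G := by
  induction h with
  | zero => exact .zero
  | add _ _ hf hg => exact hf.add hg
  | C_mul_X_pow h hle => exact .C_mul_X_pow h (hle.trans_le hde)

lemma sum {ι : Type*} {s : Finset ι} {F : ι → (MvPolynomial ℕ ℤ)[X]}
    (h : ∀ i ∈ s, MarkedWeightLT d (F i)) : MarkedWeightLT d (∑ i ∈ s, F i) := by
  classical
  induction s using Finset.induction_on with
  | empty => exact .zero
  | insert a s ha ih =>
    rw [sum_insert ha]
    exact (h a (mem_insert_self a s)).add (ih fun i hi => h i (mem_insert_of_mem hi))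

lemma X_pow_mul (h : MarkedWeightLT d G) (m : ℕ) : MarkedWeightLT (d + m) (X ^ m * G) := by
  induction h with
  | zero => rw [mul_zero]; exact .zero
  | add _ _ hf hg => rw [mul_add]; exact hf.add hg
  | C_mul_X_pow h hle =>
    rw [mul_left_comm, ← pow_add]
    exact .C_mul_X_pow h (by omega)

lemma C_X_mul (h : MarkedWeightLT d G) (r : ℕ) :
    MarkedWeightLT (d + r + 1) (C (MvPolynomial.X r) * G) := by
  induction h with
  | zero => rw [mul_zero]; exact .zero
  | add _ _ hf hg => rw [mul_add]; exact hf.add hg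
  | C_mul_X_pow h hle =>
    rw [← mul_assoc, ← C_mul]
    exact .C_mul_X_pow (h.X_mul r le_rfl) (by omega)

lemma closeOp (h : MarkedWeightLT d G) : WeightLE d (closeOp G) := by
  induction h with
  | zero => rw [map_zero]; simpa using WeightLE.const d 0
  | add _ _ hf hg => rw [map_add]; exact hf.add hg
  | C_mul_X_pow h hle =>
    rw [closeOp_C_mul_X_pow, mul_comm]
    exact h.X_mul _ (by omega)

lemma cutOp (h : MarkedWeightLT d G) : MarkedWeightLT d (cutOp G) := by
  induction h with
  | zero => rw [map_zero]; exact .zero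
  | add _ _ hf hg => rw [map_add]; exact hf.add hg
  | @C_mul_X_pow e c f h hle =>
    rw [cutOp_C_mul_X_pow, cutSum, mul_sum]
    refine .sum fun r hr => ?_
    have := mem_range.1 hr
    rw [← mul_assoc, ← C_mul, mul_comm f]
    exact .C_mul_X_pow (h.X_mul r le_rfl) (by omega)

lemma joinDer {f : MvPolynomial ℕ ℤ} (h : WeightLE e f) (hd : e < d) :
    MarkedWeightLT d (joinDer f) := by
  induction h generalizing d with
  | const e a =>
    rw [← MvPolynomial.algebraMap_eq, Derivation.map_algebraMap]
    exact .zero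
  | add _ _ hf hg => rw [map_add]; exact (hf hd).add (hg hd)
  | @X_mul e e' r f h hle ih =>
    rw [joinDer_X_mul]
    refine .add ((ih (Nat.lt_succ_self e')).C_X_mul r |>.mono (by omega)) ?_
    rw [show ((r : (MvPolynomial ℕ ℤ)[X]) + 1) * X ^ (r + 1) * C f =
      C ((r + 1) • f) * X ^ (r + 1) by simp]
    exact .C_mul_X_pow (h.nsmul _) (by omega)

lemma exists_laxOp (h : MarkedWeightLT d G) :
    ∃ H, laxOp G = X * G + H ∧ MarkedWeightLT d H := by
  induction h with
  | zero => exact ⟨0, by simp, .zero⟩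
  | @add F G _ _ hF hG =>
    obtain ⟨F', hF, hF'⟩ := hF
    obtain ⟨G', hG, hG'⟩ := hG
    exact ⟨F' + G', by rw [map_add, hF, hG]; ring, hF'.add hG'⟩
  | @C_mul_X_pow e c f h hle =>
    refine ⟨_root_.cutOp (C f * X ^ c) + X ^ c * _root_.joinDer f, ?_,
      (cutOp (.C_mul_X_pow h hle)).add ?_⟩
    · rw [laxOp_apply, joinOp_C_mul_X_pow]; ring
    · exact ((joinDer h (Nat.lt_succ_self e)).X_pow_mul c).mono (by omega)

lemma exists_laxOp_iterate_C {f : MvPolynomial ℕ ℤ} (h : WeightLE e f) (r : ℕ) :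
    ∃ H, laxOp^[r] (C f) = C f * X ^ r + H ∧ MarkedWeightLT (e + r) H := by
  induction r with
  | zero => exact ⟨0, by simp, .zero⟩
  | succ r ih =>
    obtain ⟨H, hH, hH'⟩ := ih
    obtain ⟨F, hF, hF'⟩ := exists_laxOp (C_mul_X_pow h (Nat.lt_succ_self (e + r)))
    obtain ⟨G, hG, hG'⟩ := exists_laxOp hH'
    refine ⟨F + (X * H + G), ?_, hF'.add (.add ?_ (hG'.mono (Nat.le_succ _)))⟩
    · rw [Function.iterate_succ_apply', hH, map_add, hF, hG]; ring
    · simpa using hH'.X_pow_mul 1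

end MarkedWeightLT

lemma closeOp_laxOp_induction {p : MvPolynomial ℕ ℤ → Prop} (const : ∀ a, p (MvPolynomial.C a))
    (add : ∀ f g, p f → p g → p (f + g)) (neg : ∀ f, p f → p (-f))
    (lax : ∀ r f, p f → p (closeOp (laxOp^[r] (C f)))) (f : MvPolynomial ℕ ℤ) : p f := by
  obtain ⟨d, hd⟩ := exists_weightLE f
  induction d using Nat.strong_induction_on generalizing f with
  | _ d ih =>
    induction hd with
    | const d a => exact const a
    | add _ _ hf hg => exact add _ _ (hf ih) (hg ih)
    | @X_mul d e r f h hle _ =>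
      obtain ⟨H, hH, hH'⟩ := MarkedWeightLT.exists_laxOp_iterate_C h r
      have h1 := lax r f (ih e (by omega) f h)
      rw [hH, map_add, closeOp_C_mul_X_pow] at h1
      have h2 := add _ _ h1 (neg _ (ih (e + r) (by omega) _ hH'.closeOp))
      rwa [add_neg_cancel_right, mul_comm] at h2

end Filtration

section Dimension
open MvPowerSeries

lemma coeff_prod_X_pow_mul_expSeries {N : ℕ} (a : Fin N → ℕ) (l : Fin N →₀ ℕ) :
    coeff l ((∏ j, (X j : MvPowerSeries (Fin N) ℚ) ^ a j) * expSeries N) =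
      (∏ j, ((l j).descFactorial (a j) : ℚ)) * ∏ j, ((l j).factorial : ℚ)⁻¹ := by
  have h : (∏ j, (X j : MvPowerSeries (Fin N) ℚ) ^ a j) =
      monomial (Finsupp.equivFunOnFinite.symm a) 1 := by
    have h1 : ∑ j, Finsupp.single j (a j) = Finsupp.equivFunOnFinite.symm a := by
      ext j
      simp [Finsupp.finsetSum_apply, Finsupp.single_apply]
    simp only [X_pow_eq, prod_monomial, prod_const_one, h1]
  rw [h, coeff_monomial_mul, coeff_expSeries, one_mul, ← prod_mul_distrib]
  split_ifs with hl
  · refine prod_congr rfl fun j _ => ?_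
    have hj : a j ≤ l j := hl j
    rw [← Nat.factorial_mul_descFactorial hj, Finsupp.tsub_apply, Finsupp.equivFunOnFinite_symm_apply_apply]
    have h1 : ((l j).descFactorial (a j) : ℚ) ≠ 0 := by
      rw [Nat.cast_ne_zero, Ne, Nat.descFactorial_eq_zero_iff_lt]
      omega
    push_cast
    field_simp
  · obtain ⟨j, hj⟩ : ∃ j, l j < a j := by
      by_contra! hc
      exact hl fun j => hc j
    exact (prod_eq_zero (mem_univ j) (by rw [Nat.descFactorial_eq_zero_iff_lt.2 hj]; simp)).symm

/-- The Vandermonde product `∏_{i<j} (x_j - x_i)` of rational numbers. -/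
def vdmProd {N : ℕ} (x : Fin N → ℚ) : ℚ := ∏ i, ∏ j ∈ Ioi i, (x j - x i)

lemma coeff_dimSeries {N : ℕ} (l : Fin N →₀ ℕ) :
    coeff l (dimSeries N) = (∏ i : Fin N, (-1) ^ (i : ℕ)) *
      (vdmProd (fun i => (l i : ℚ)) * ∏ i, ((l i).factorial : ℚ)⁻¹) := by
  have hs (s : Perm (Fin N)) : coeff l ((∏ i : Fin N, (-X (s i)) ^ (i : ℕ)) * expSeries N) =
      (∏ i : Fin N, (-1) ^ (i : ℕ)) * ((∏ i : Fin N, ((l (s i)).descFactorial (i : ℕ) : ℚ)) *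
        ∏ i, ((l i).factorial : ℚ)⁻¹) := by
    have h1 : ∏ i : Fin N, (-X (s i) : MvPowerSeries (Fin N) ℚ) ^ (i : ℕ) =
        C (∏ i : Fin N, (-1 : ℚ) ^ (i : ℕ)) * ∏ j, X j ^ (s.symm j : ℕ) := by
      rw [← Equiv.prod_comp s fun j => (X j : MvPowerSeries (Fin N) ℚ) ^ (s.symm j : ℕ), map_prod,
        ← prod_mul_distrib]
      refine prod_congr rfl fun i _ => ?_
      rw [Equiv.symm_apply_apply, map_pow, map_neg, map_one, ← mul_pow, neg_one_mul]
    rw [h1, mul_assoc, coeff_C_mul, coeff_prod_X_pow_mul_expSeries,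
      ← Equiv.prod_comp s fun j => ((l j).descFactorial (s.symm j : ℕ) : ℚ)]
    simp only [Equiv.symm_apply_apply]
  have hdet := Matrix.det_eval_matrixOfPolynomials_eq_det_vandermonde (fun i => (l i : ℚ))
    (fun i : Fin N => descPochhammer ℚ i) (fun i => descPochhammer_natDegree ℚ i)
    (fun i => monic_descPochhammer ℚ i)
  rw [Matrix.det_vandermonde, Matrix.det_apply] at hdet
  simp only [Matrix.of_apply, descPochhammer_eval_eq_descFactorial] at hdet
  rw [dimSeries, vdmSeries_eq_sum, sum_mul, map_sum, vdmProd, hdet, sum_mul, mul_sum]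
  refine sum_congr rfl fun s _ => ?_
  rw [smul_mul_assoc, map_zsmul, hs, Units.smul_def, zsmul_eq_mul, zsmul_eq_mul]
  ring

lemma vdmProd_eq_zero {N : ℕ} {x : Fin N → ℚ} (hx : ¬ Function.Injective x) : vdmProd x = 0 := by
  rw [vdmProd, ← Matrix.det_vandermonde]
  by_contra h
  exact hx (Matrix.det_vandermonde_ne_zero_iff.1 h)

lemma vdmProd_ne_zero {N : ℕ} {x : Fin N → ℚ} (hx : Function.Injective x) : vdmProd x ≠ 0 := by
  rw [vdmProd, ← Matrix.det_vandermonde]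
  exact Matrix.det_vandermonde_ne_zero_iff.2 hx

lemma vdmProd_comp_swap {N : ℕ} (x : Fin N → ℚ) {a b : Fin N} (hab : a ≠ b) :
    vdmProd (x ∘ Equiv.swap a b) = -vdmProd x := by
  rw [vdmProd, vdmProd, ← Matrix.det_vandermonde, ← Matrix.det_vandermonde]
  have := Matrix.det_permute (Equiv.swap a b) (Matrix.vandermonde x)
  rw [Perm.sign_swap hab] at this
  rw [show Matrix.vandermonde (x ∘ Equiv.swap a b) =
    (Matrix.vandermonde x).submatrix (Equiv.swap a b) id from rfl, this]
  simp

lemma vdmProd_update_mul {N : ℕ} (x : Fin N → ℚ) (i : Fin N) (t : ℚ) :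
    vdmProd (Function.update x i t) * ∏ j ∈ univ.erase i, (x i - x j) =
      vdmProd x * ∏ j ∈ univ.erase i, (t - x j) := by
  have key (y : Fin N → ℚ) : vdmProd y = (∏ j ∈ univ.erase i, (y i - y j)) *
      ((∏ j ∈ univ.erase i, if i < j then -1 else 1) *
        ∏ a ∈ univ.erase i, ∏ b ∈ univ.erase i, if a < b then y b - y a else 1) := by
    have h1 (a : Fin N) : ∏ b ∈ Ioi a, (y b - y a) = ∏ b, if a < b then y b - y a else 1 := by
      rw [prod_ite, prod_const_one, mul_one]
      exact prod_congr (by ext; simp) fun _ _ => rfl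
    simp only [vdmProd, h1]
    rw [← mul_prod_erase _ _ (mem_univ i), ← mul_prod_erase _ _ (mem_univ i)]
    simp only [lt_irrefl, if_false, one_mul]
    have h2 : ∏ a ∈ univ.erase i, ∏ b, (if a < b then y b - y a else 1) =
        ∏ a ∈ univ.erase i, ((if a < i then y i - y a else 1) *
          ∏ b ∈ univ.erase i, if a < b then y b - y a else 1) :=
      prod_congr rfl fun a _ => (mul_prod_erase univ _ (mem_univ i)).symm
    rw [h2, ← prod_mul_distrib, ← mul_assoc, ← prod_mul_distrib, ← prod_mul_distrib]
    refine prod_congr rfl fun j hj => ?_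
    rw [← mul_assoc]
    congr 1
    rcases lt_or_gt_of_ne (ne_of_mem_erase hj) with h | h
    · simp [h, h.not_gt]
    · simp [h, h.not_gt]
  rw [key, key x]
  have h2 (j : Fin N) (hj : j ∈ univ.erase i) : Function.update x i t j = x j :=
    Function.update_of_ne (ne_of_mem_erase hj) _ _
  have h3 : ∏ j ∈ univ.erase i, (Function.update x i t i - Function.update x i t j) =
      ∏ j ∈ univ.erase i, (t - x j) :=
    prod_congr rfl fun j hj => by rw [h2 j hj, Function.update_self]
  have h4 : (∏ a ∈ univ.erase i, ∏ b ∈ univ.erase i,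
      if a < b then Function.update x i t b - Function.update x i t a else 1) =
      ∏ a ∈ univ.erase i, ∏ b ∈ univ.erase i, if a < b then x b - x a else 1 :=
    prod_congr rfl fun a ha => prod_congr rfl fun b hb => by rw [h2 a ha, h2 b hb]
  rw [h3, h4]
  ring

end Dimension

section ContentSeries
open PowerSeries

/-- The geometric series `∑ cⁿ Xⁿ`. -/
noncomputable def geomSeries {A : Type*} [CommRing A] (c : A) : A⟦X⟧ := mk fun n => c ^ n

lemma one_sub_mul_geomSeries {A : Type*} [CommRing A] (c : A) :
    (1 - C c * X) * geomSeries c = 1 := by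
  rw [sub_mul, one_mul, mul_assoc, mul_comm X]
  ext n
  cases n with
  | zero => simp [geomSeries]
  | succ n => 
    rw [map_sub, coeff_C_mul, coeff_succ_mul_X, geomSeries, coeff_mk, coeff_mk, coeff_one,
      if_neg n.succ_ne_zero]
    ring

lemma map_geomSeries {A B : Type*} [CommRing A] [CommRing B] (φ : A →+* B) (c : A) :
    map φ (geomSeries c) = geomSeries (φ c) := by
  ext n
  simp [geomSeries]

lemma lagrange_shift_identity {N : ℕ} {y w : Fin N → ℚ} (hy : Function.Injective y)
    (hw : ∀ i, w i * ∏ j ∈ univ.erase i, (y i - y j) =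
      (y i + N) * ∏ j ∈ univ.erase i, (y i - 1 - y j)) (z : ℚ) :
    (z + N) * ∏ i, (z - 1 - y i) =
      z * ∏ i, (z - y i) - ∑ i, w i * ∏ j ∈ univ.erase i, (z - y j) := by
  let P : Polynomial ℚ := (Polynomial.X - Polynomial.C (-N : ℚ)) *
    ∏ i, (Polynomial.X - Polynomial.C (1 + y i))
  let Q : Polynomial ℚ := (Polynomial.X - Polynomial.C 0) * ∏ i, (Polynomial.X - Polynomial.C (y i))
  let L : Polynomial ℚ := ∑ i, Polynomial.C (w i) *
    ∏ j ∈ univ.erase i, (Polynomial.X - Polynomial.C (y j))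
  have hmon (x : Fin N → ℚ) : (∏ i, (Polynomial.X - Polynomial.C (x i))).Monic :=
    Polynomial.monic_prod_X_sub_C _ _
  have hmon' (a : ℚ) (x : Fin N → ℚ) : ((Polynomial.X - Polynomial.C a) *
      ∏ i, (Polynomial.X - Polynomial.C (x i))).Monic := (Polynomial.monic_X_sub_C a).mul (hmon x)
  have hdeg (a : ℚ) (x : Fin N → ℚ) : ((Polynomial.X - Polynomial.C a) *
      ∏ i, (Polynomial.X - Polynomial.C (x i))).natDegree = N + 1 := by
    rw [(Polynomial.monic_X_sub_C a).natDegree_mul (hmon x), Polynomial.natDegree_X_sub_C,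
      Polynomial.natDegree_finsetProd_X_sub_C_eq_card, card_univ, Fintype.card_fin, add_comm]
  have hnext (a : ℚ) (x : Fin N → ℚ) : ((Polynomial.X - Polynomial.C a) *
      ∏ i, (Polynomial.X - Polynomial.C (x i))).coeff N = -a - ∑ i, x i := by
    have h1 := (Polynomial.monic_X_sub_C a).nextCoeff_mul (hmon x)
    rw [Polynomial.prod_X_sub_C_nextCoeff, Polynomial.nextCoeff_X_sub_C,
      Polynomial.nextCoeff_of_natDegree_pos (by rw [hdeg]; omega), hdeg] at h1
    simpa [sub_eq_add_neg] using h1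
  have hPQ : (P - Q).degree < N := by
    rw [Polynomial.degree_lt_iff_coeff_zero]
    intro m hm
    rw [Polynomial.coeff_sub]
    obtain rfl | rfl | hm2 : m = N ∨ m = N + 1 ∨ N + 1 < m := by omega
    · rw [hnext, hnext, sum_add_distrib]
      simp
    · have h1 := hmon' (-N : ℚ) fun i => 1 + y i
      have h2 := hmon' 0 y
      rw [Polynomial.Monic, Polynomial.leadingCoeff, hdeg] at h1 h2
      rw [h1, h2, sub_self]
    · rw [Polynomial.coeff_eq_zero_of_natDegree_lt (by rw [hdeg]; exact hm2),
        Polynomial.coeff_eq_zero_of_natDegree_lt (by rw [hdeg]; exact hm2), sub_self]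
  have hL : (-L).degree < N := by
    rw [Polynomial.degree_neg]
    refine lt_of_le_of_lt (Polynomial.degree_sum_le _ _) ((Finset.sup_lt_iff ?_).2 fun i _ => ?_)
    · exact WithBot.bot_lt_coe N
    · refine lt_of_le_of_lt (Polynomial.degree_mul_le_of_le Polynomial.degree_C_le le_rfl) ?_
      rw [zero_add, Polynomial.degree_eq_natDegree (Polynomial.monic_prod_X_sub_C _ _).ne_zero,
        Polynomial.natDegree_finsetProd_X_sub_C_eq_card, card_erase_of_mem (mem_univ i), card_univ,
        Fintype.card_fin]
      exact_mod_cast Nat.sub_lt (Fin.pos i) one_pos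
  have heq : P - Q = -L := by
    refine Polynomial.eq_of_degrees_lt_of_eval_index_eq (s := univ) (v := y) hy.injOn
      (by simpa using hPQ) (by simpa using hL) fun i _ => ?_
    have h1 : Polynomial.eval (y i) L = w i * ∏ j ∈ univ.erase i, (y i - y j) := by
      simp only [L, Polynomial.eval_finsetSum, Polynomial.eval_mul, Polynomial.eval_C,
        Polynomial.eval_prod, Polynomial.eval_sub, Polynomial.eval_X]
      refine sum_eq_single i (fun b _ hb => ?_) (by simp)
      rw [prod_eq_zero (mem_erase.2 ⟨hb.symm, mem_univ i⟩) (sub_self _), mul_zero]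
    rw [Polynomial.eval_neg, h1, hw, Polynomial.eval_sub]
    simp only [P, Q, Polynomial.eval_mul, Polynomial.eval_C, Polynomial.eval_prod,
      Polynomial.eval_sub, Polynomial.eval_X]
    rw [prod_eq_zero (f := fun j => y i - y j) (mem_univ i) (sub_self (y i)),
      ← mul_prod_erase _ _ (mem_univ i)]
    simp only [sub_sub]
    ring
  have h := congrArg (Polynomial.eval z) heq
  simp only [P, Q, L, Polynomial.eval_neg, Polynomial.eval_mul, Polynomial.eval_C,
    Polynomial.eval_prod, Polynomial.eval_sub, Polynomial.eval_X, Polynomial.eval_finsetSum] at h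
  simp only [sub_sub]
  linear_combination h

lemma prod_one_sub_mul_prod_geomSeries {N : ℕ} (y : Fin N → ℚ) (s : Finset (Fin N)) :
    (∏ i ∈ s, (1 - C (y i) * X)) * ∏ i ∈ s, geomSeries (y i) = 1 := by
  rw [← prod_mul_distrib]
  exact prod_eq_one fun i _ => one_sub_mul_geomSeries (y i)

lemma lagrange_shift_series {N : ℕ} {y w : Fin N → ℚ} (hy : Function.Injective y)
    (hw : ∀ i, w i * ∏ j ∈ univ.erase i, (y i - y j) =
      (y i + N) * ∏ j ∈ univ.erase i, (y i - 1 - y j)) :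
    (1 + C (N : ℚ) * X) * ∏ i, ((1 - C (y i + 1) * X) * geomSeries (y i)) =
      1 - X ^ 2 * ∑ i, C (w i) * geomSeries (y i) := by
  have hpoly : (1 + Polynomial.C (N : ℚ) * Polynomial.X) *
      ∏ i, (1 - Polynomial.C (y i + 1) * Polynomial.X) =
      ∏ i, (1 - Polynomial.C (y i) * Polynomial.X) - Polynomial.X ^ 2 * ∑ i, Polynomial.C (w i) *
        ∏ j ∈ univ.erase i, (1 - Polynomial.C (y j) * Polynomial.X) := by
    refine Polynomial.eq_of_infinite_eval_eq _ _ ((Set.finite_singleton (0 : ℚ)).infinite_compl.mono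
      fun u hu => ?_)
    have hu : u ≠ 0 := hu
    have h := lagrange_shift_identity hy hw u⁻¹
    have h1 (x : Fin N → ℚ) (s : Finset (Fin N)) :
        ∏ i ∈ s, (1 - x i * u) = u ^ #s * ∏ i ∈ s, (u⁻¹ - x i) := by
      rw [← prod_const, ← prod_mul_distrib]
      refine prod_congr rfl fun i _ => ?_
      field_simp
    simp only [Set.mem_ofPred_eq, Polynomial.eval_mul, Polynomial.eval_C, Polynomial.eval_prod,
      Polynomial.eval_sub, Polynomial.eval_X, Polynomial.eval_finsetSum, Polynomial.eval_add,
      Polynomial.eval_one, Polynomial.eval_pow]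
    have h2 : u ^ 2 * ∑ i, w i * ∏ j ∈ univ.erase i, (1 - y j * u) =
        u * u ^ N * ∑ i, w i * ∏ j ∈ univ.erase i, (u⁻¹ - y j) := by
      rw [mul_sum, mul_sum]
      refine sum_congr rfl fun i _ => ?_
      rw [h1, card_erase_of_mem (mem_univ i), card_univ, Fintype.card_fin]
      obtain ⟨M, rfl⟩ : ∃ M, N = M + 1 := ⟨N - 1, by have := Fin.pos i; omega⟩
      rw [Nat.add_sub_cancel]
      ring
    have h3 : u * (u⁻¹ + N) = 1 + N * u := by field_simp
    have h4 : u * u⁻¹ = 1 := mul_inv_cancel₀ hu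
    rw [h1 (fun i => y i + 1), h1 y, h2, ← h3, card_univ, Fintype.card_fin]
    rw [prod_congr rfl fun i _ => show u⁻¹ - (y i + 1) = u⁻¹ - 1 - y i by ring]
    linear_combination u * u ^ N * h + u ^ N * (∏ i, (u⁻¹ - y i)) * h4
  have h := congrArg (Polynomial.coeToPowerSeries.ringHom (R := ℚ)) hpoly
  simp only [map_mul, map_add, map_sub, map_one, map_prod, map_sum, map_pow,
    Polynomial.coeToPowerSeries.ringHom_apply, Polynomial.coe_C, Polynomial.coe_X] at h
  rw [prod_mul_distrib, ← mul_assoc]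
  simp only [map_add, map_one]
  rw [h, sub_mul, prod_one_sub_mul_prod_geomSeries, mul_assoc,
    sum_mul]
  congr 2
  refine sum_congr rfl fun i _ => ?_
  rw [← mul_prod_erase _ _ (mem_univ i)]
  linear_combination C (w i) * geomSeries (y i) * prod_one_sub_mul_prod_geomSeries y (univ.erase i)

/-- The generating series `(1 + N u) ∏ᵢ (1 - (yᵢ + 1) u) / (1 - yᵢ u)`, with `yᵢ = lᵢ - N`. -/
noncomputable def contentSeries {N : ℕ} (l : Fin N →₀ ℕ) : ℚ⟦X⟧ :=
  (1 + C (N : ℚ) * X) *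
    ∏ i, ((1 - C ((l i : ℚ) - N + 1) * X) * geomSeries ((l i : ℚ) - N))

lemma contentSeries_tsub_single {N : ℕ} (l : Fin N →₀ ℕ) (i : Fin N) (h : 0 < l i) :
    contentSeries (l - Finsupp.single i 1) = contentSeries l *
      (1 - C ((l i : ℚ) - N) * X) ^ 2 * geomSeries ((l i : ℚ) - N + 1) *
        geomSeries ((l i : ℚ) - N - 1) := by
  have h1 : ∏ j ∈ univ.erase i, ((1 - C (((l - Finsupp.single i 1 : Fin N →₀ ℕ) j : ℚ) - N + 1) * X) *
      geomSeries (((l - Finsupp.single i 1 : Fin N →₀ ℕ) j : ℚ) - N)) =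
      ∏ j ∈ univ.erase i, ((1 - C ((l j : ℚ) - N + 1) * X) * geomSeries ((l j : ℚ) - N)) :=
    prod_congr rfl fun j hj => by
      rw [Finsupp.tsub_apply, Finsupp.single_eq_of_ne (ne_of_mem_erase hj), tsub_zero]
  rw [contentSeries, contentSeries, ← mul_prod_erase _ _ (mem_univ i), h1,
    ← mul_prod_erase _ _ (mem_univ i), Finsupp.tsub_apply, Finsupp.single_eq_same, Nat.cast_sub h,
    Nat.cast_one, show (l i : ℚ) - 1 - N + 1 = l i - N by ring,
    show (l i : ℚ) - 1 - N = l i - N - 1 by ring]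
  have h2 := one_sub_mul_geomSeries ((l i : ℚ) - N + 1)
  have h3 := one_sub_mul_geomSeries ((l i : ℚ) - N)
  have h4 : (1 - C ((l i : ℚ) - N + 1) * X) * geomSeries ((l i : ℚ) - N + 1) *
      ((1 - C ((l i : ℚ) - N) * X) * geomSeries ((l i : ℚ) - N)) = 1 := by rw [h2, h3, one_mul]
  linear_combination (-(1 + C (N : ℚ) * X) *
    (∏ j ∈ univ.erase i, ((1 - C ((l j : ℚ) - N + 1) * X) * geomSeries ((l j : ℚ) - N))) *
    (1 - C ((l i : ℚ) - N) * X) * geomSeries ((l i : ℚ) - N - 1)) * h4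

end ContentSeries

section Moments

lemma coeff_X_mul_dimSeries {N : ℕ} (l : Fin N →₀ ℕ) (i : Fin N) :
    MvPowerSeries.coeff l (MvPowerSeries.X i * dimSeries N) =
      (∏ i : Fin N, (-1) ^ (i : ℕ)) * (l i * vdmProd (Function.update (fun j => (l j : ℚ)) i (l i - 1)) *
        ∏ i, ((l i).factorial : ℚ)⁻¹) := by
  rw [coeff_X_mul_eq_ite]
  split_ifs with h
  · rw [coeff_dimSeries]
    have h1 : (fun j => (((l - Finsupp.single i 1 : Fin N →₀ ℕ) j : ℕ) : ℚ)) =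
        Function.update (fun j => (l j : ℚ)) i (l i - 1) := by
      funext j
      rcases eq_or_ne j i with rfl | hj
      · rw [Function.update_self, Finsupp.tsub_apply, Finsupp.single_eq_same, Nat.cast_sub h,
          Nat.cast_one]
      · rw [Function.update_of_ne hj, Finsupp.tsub_apply, Finsupp.single_eq_of_ne hj, tsub_zero]
    have h2 : ∏ j, (((l - Finsupp.single i 1 : Fin N →₀ ℕ) j).factorial : ℚ)⁻¹ =
        l i * ∏ j, ((l j).factorial : ℚ)⁻¹ := by
      rw [← mul_prod_erase _ _ (mem_univ i), ← mul_prod_erase univ _ (mem_univ i), ← mul_assoc]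
      congr 1
      · rw [Finsupp.tsub_apply, Finsupp.single_eq_same, ← Nat.mul_factorial_pred h.ne']
        have : (l i : ℚ) ≠ 0 := by exact_mod_cast h.ne'
        push_cast
        field_simp
      · refine prod_congr rfl fun j hj => ?_
        rw [Finsupp.tsub_apply, Finsupp.single_eq_of_ne (ne_of_mem_erase hj), tsub_zero]
    rw [h1, h2]
    ring
  · rw [Nat.eq_zero_of_not_pos h]
    simp

lemma sum_pow_mul_coeff_X_mul_dimSeries {N : ℕ} (l : Fin N →₀ ℕ) (a : ℕ) :
    ∑ i, ((l i : ℚ) - N) ^ a * MvPowerSeries.coeff l (MvPowerSeries.X i * dimSeries N) =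
      -PowerSeries.coeff (a + 2) (contentSeries l) * MvPowerSeries.coeff l (dimSeries N) := by
  by_cases hl : Function.Injective l
  · have hlQ : Function.Injective fun i => (l i : ℚ) := Nat.cast_injective.comp hl
    have hD : MvPowerSeries.coeff l (dimSeries N) ≠ 0 := by
      rw [coeff_dimSeries]
      refine mul_ne_zero (prod_ne_zero_iff.2 fun i _ => by positivity) (mul_ne_zero
        (vdmProd_ne_zero hlQ) (prod_ne_zero_iff.2 fun i _ => by positivity))
    have h := congrArg (PowerSeries.coeff (a + 2)) (lagrange_shift_series
      (y := fun i => (l i : ℚ) - N) (w := fun i => MvPowerSeries.coeff l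
        (MvPowerSeries.X i * dimSeries N) / MvPowerSeries.coeff l (dimSeries N))
      (fun i j hij => hlQ (sub_left_injective hij)) fun i => by
        have h1 := vdmProd_update_mul (fun j => (l j : ℚ)) i (l i - 1)
        have h2 : ∏ j ∈ univ.erase i, ((l i : ℚ) - N - (l j - N)) =
            ∏ j ∈ univ.erase i, ((l i : ℚ) - l j) := prod_congr rfl fun j _ => by ring
        have h3 : ∏ j ∈ univ.erase i, ((l i : ℚ) - N - 1 - (l j - N)) =
            ∏ j ∈ univ.erase i, ((l i : ℚ) - 1 - l j) := prod_congr rfl fun j _ => by ring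
        rw [h2, h3, div_mul_eq_mul_div, div_eq_iff hD, coeff_X_mul_dimSeries, coeff_dimSeries]
        linear_combination (∏ i : Fin N, (-1) ^ (i : ℕ)) * (∏ i, ((l i).factorial : ℚ)⁻¹) *
          (l i : ℚ) * h1)
    rw [show (1 + PowerSeries.C (N : ℚ) * PowerSeries.X) * ∏ i, ((1 - PowerSeries.C
      ((l i : ℚ) - N + 1) * PowerSeries.X) * geomSeries ((l i : ℚ) - N)) = contentSeries l from rfl,
      map_sub, PowerSeries.coeff_one, if_neg (by omega), PowerSeries.coeff_X_pow_mul, map_sum] at h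
    rw [h, zero_sub, neg_neg, sum_mul]
    refine sum_congr rfl fun i _ => ?_
    rw [PowerSeries.coeff_C_mul, geomSeries, PowerSeries.coeff_mk]
    field_simp
  · have h0 : MvPowerSeries.coeff l (dimSeries N) = 0 := by
      rw [coeff_dimSeries, vdmProd_eq_zero fun h => hl fun i j hij => h (by simp [hij])]
      ring
    obtain ⟨b, c, hbc, hne⟩ : ∃ b c, l b = l c ∧ b ≠ c := by
      simpa [Function.Injective] using hl
    rw [h0, mul_zero]
    have hsw (j : Fin N) : l (swap b c j) = l j := by
      rcases eq_or_ne j b with rfl | hb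
      · rw [swap_apply_left, hbc]
      rcases eq_or_ne j c with rfl | hc
      · rw [swap_apply_right, hbc]
      rw [swap_apply_of_ne_of_ne hb hc]
    have h1 (i : Fin N) : MvPowerSeries.coeff l (MvPowerSeries.X (swap b c i) * dimSeries N) =
        -MvPowerSeries.coeff l (MvPowerSeries.X i * dimSeries N) := by
      have h2 : Function.update (fun j => (l j : ℚ)) (swap b c i) (l i - 1) =
          Function.update (fun j => (l j : ℚ)) i (l i - 1) ∘ swap b c := by
        rw [Function.update_comp_equiv, symm_swap]
        congr 1
        funext j
        simp [hsw]
      rw [coeff_X_mul_dimSeries, coeff_X_mul_dimSeries, hsw, h2, vdmProd_comp_swap _ hne]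
      ring
    have h3 := Equiv.sum_comp (swap b c) fun i =>
      ((l i : ℚ) - N) ^ a * MvPowerSeries.coeff l (MvPowerSeries.X i * dimSeries N)
    simp only [hsw, h1, mul_neg, sum_neg_distrib] at h3
    linarith

/-- The generic content series `∑ X_n uⁿ`. -/
noncomputable def momentSeries : PowerSeries (Polynomial (MvPolynomial ℕ ℤ)) :=
  PowerSeries.mk fun n => Polynomial.C (MvPolynomial.X n)

/-- The generic content series after removal of a box of marked content. -/
noncomputable def shiftedMomentSeries : PowerSeries (Polynomial (MvPolynomial ℕ ℤ)) :=
  momentSeries * (1 - PowerSeries.C Polynomial.X * PowerSeries.X) ^ 2 *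
    geomSeries (Polynomial.X + 1) * geomSeries (Polynomial.X - 1)

/-- Evaluation of polynomials in the coefficients of the content series of `l`. -/
noncomputable def momentEval {N : ℕ} (l : Fin N →₀ ℕ) : MvPolynomial ℕ ℤ →ₐ[ℤ] ℚ :=
  MvPolynomial.aeval fun n => PowerSeries.coeff n (contentSeries l)

/-- Evaluation at the content series of `l`, the marked variable being sent to `lᵢ - N`. -/
noncomputable def momentEvalMark {N : ℕ} (l : Fin N →₀ ℕ) (i : Fin N) :
    Polynomial (MvPolynomial ℕ ℤ) →+* ℚ :=
  Polynomial.eval₂RingHom (momentEval l : MvPolynomial ℕ ℤ →+* ℚ) (l i - N)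

lemma momentEvalMark_C {N : ℕ} (l : Fin N →₀ ℕ) (i : Fin N) (f : MvPolynomial ℕ ℤ) :
    momentEvalMark l i (Polynomial.C f) = momentEval l f := by
  simp [momentEvalMark]

lemma momentEvalMark_X {N : ℕ} (l : Fin N →₀ ℕ) (i : Fin N) :
    momentEvalMark l i Polynomial.X = l i - N := by
  simp [momentEvalMark]

lemma momentEvalMark_coeff_shiftedMomentSeries {N : ℕ} (l : Fin N →₀ ℕ) (i : Fin N)
    (h : 0 < l i) (n : ℕ) :
    momentEvalMark l i (PowerSeries.coeff n shiftedMomentSeries) =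
      PowerSeries.coeff n (contentSeries (l - Finsupp.single i 1)) := by
  have h1 : PowerSeries.map (momentEvalMark l i) momentSeries = contentSeries l := by
    ext n
    rw [PowerSeries.coeff_map, momentSeries, PowerSeries.coeff_mk, momentEvalMark_C, momentEval,
      MvPolynomial.aeval_X]
  rw [← PowerSeries.coeff_map, shiftedMomentSeries, contentSeries_tsub_single l i h]
  simp only [map_mul, map_pow, map_sub, map_one, map_geomSeries, map_add, PowerSeries.map_C,
    PowerSeries.map_X, momentEvalMark_X, h1]

lemma momentEvalMark_aeval_shiftedMomentSeries {N : ℕ} (l : Fin N →₀ ℕ) (i : Fin N)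
    (h : 0 < l i) (W : MvPolynomial ℕ ℤ) :
    momentEvalMark l i (MvPolynomial.aeval (fun n => PowerSeries.coeff n shiftedMomentSeries) W) =
      momentEval (l - Finsupp.single i 1) W := by
  induction W using MvPolynomial.induction_on with
  | C a => simp
  | add f g hf hg => rw [map_add, map_add, map_add, hf, hg]
  | mul_X f n hf =>
    rw [map_mul, map_mul, map_mul, hf, MvPolynomial.aeval_X,
      momentEvalMark_coeff_shiftedMomentSeries l i h, momentEval, MvPolynomial.aeval_X]

lemma sum_pow_mul_momentEvalMark_mul_coeff {N : ℕ} (l : Fin N →₀ ℕ) (a : ℕ)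
    (G : Polynomial (MvPolynomial ℕ ℤ)) :
    ∑ i, ((l i : ℚ) - N) ^ a * (momentEvalMark l i G *
      MvPowerSeries.coeff l (MvPowerSeries.X i * dimSeries N)) =
      momentEval l (-closeOp (Polynomial.X ^ (a + 2) * G)) *
        MvPowerSeries.coeff l (dimSeries N) := by
  induction G using polynomial_induction_C_mul_X_pow with
  | add G H hG hH =>
    simp only [map_add, mul_add, add_mul, sum_add_distrib, hG, hH, neg_add]
  | mono f c =>
    have h := sum_pow_mul_coeff_X_mul_dimSeries l (a + c)
    rw [mul_left_comm, ← pow_add, closeOp_C_mul_X_pow, map_neg, map_mul,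
      show a + 2 + c = a + c + 2 by ring, momentEval, MvPolynomial.aeval_X]
    rw [show ∀ x y z : ℚ, -(x * y) * z = x * (-y * z) by intros; ring, ← h, mul_sum]
    refine sum_congr rfl fun i _ => ?_
    rw [map_mul, map_pow, momentEvalMark_C, momentEvalMark_X, momentEval]
    ring

/-- The coefficients of a power sum times the dimension series are integral polynomials in the
coefficients of the content series, times the coefficients of the dimension series. -/
theorem exists_coeff_dimSeries_mul_psEval (f : MvPolynomial ℕ ℤ) :
    ∃ W : MvPolynomial ℕ ℤ, ∀ (N : ℕ) (l : Fin N →₀ ℕ),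
      MvPowerSeries.coeff l (dimSeries N * psEval N f) =
        momentEval l W * MvPowerSeries.coeff l (dimSeries N) := by
  induction f using closeOp_laxOp_induction with
  | const a =>
    refine ⟨MvPolynomial.C a, fun N l => ?_⟩
    rw [eq_intCast MvPolynomial.C a, map_intCast, map_intCast, mul_comm (dimSeries N),
      ← zsmul_eq_mul, map_zsmul, zsmul_eq_mul]
  | add f g hf hg =>
    obtain ⟨W, hW⟩ := hf
    obtain ⟨V, hV⟩ := hg
    exact ⟨W + V, fun N l => by rw [map_add, mul_add, map_add, hW, hV, map_add, add_mul]⟩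
  | neg f hf =>
    obtain ⟨W, hW⟩ := hf
    exact ⟨-W, fun N l => by rw [map_neg, mul_neg, map_neg, hW, map_neg, neg_mul]⟩
  | lax r f hf =>
    obtain ⟨W, hW⟩ := hf
    refine ⟨-closeOp (Polynomial.X ^ (r + 2) *
      MvPolynomial.aeval (fun n => PowerSeries.coeff n shiftedMomentSeries) W), fun N l => ?_⟩
    rw [coeff_dimSeries_mul_closeOp_iterate, ← sum_pow_mul_momentEvalMark_mul_coeff]
    refine sum_congr rfl fun i _ => ?_
    rw [coeff_X_mul_eq_ite, coeff_X_mul_eq_ite]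
    split_ifs with hi
    · rw [hW, momentEvalMark_aeval_shiftedMomentSeries l i hi]
    · simp only [mul_zero]

end Moments

section Characters

/-- An integral polynomial viewed as a power series with rational coefficients. -/
noncomputable def toRatSeries (N : ℕ) : MvPolynomial (Fin N) ℤ →+* MvPowerSeries (Fin N) ℚ :=
  (MvPowerSeries.map (Int.castRingHom ℚ)).comp MvPolynomial.coeToMvPowerSeries.ringHom

lemma coeff_toRatSeries {N : ℕ} (Q : MvPolynomial (Fin N) ℤ) (l : Fin N →₀ ℕ) :
    MvPowerSeries.coeff l (toRatSeries N Q) = ((MvPolynomial.coeff l Q : ℤ) : ℚ) := by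
  simp [toRatSeries]

lemma toRatSeries_X {N : ℕ} (i : Fin N) : toRatSeries N (MvPolynomial.X i) = MvPowerSeries.X i := by
  simp [toRatSeries]

lemma toRatSeries_vdm (N : ℕ) : toRatSeries N (vdm N) = vdmSeries N := by
  simp only [vdm, vdmSeries, map_prod, map_sub, toRatSeries_X]
  exact prod_congr rfl fun i _ => prod_congr (by ext; simp) fun _ _ => rfl

lemma toRatSeries_psum (N r : ℕ) : toRatSeries N (psum N r) = ∑ i, MvPowerSeries.X i ^ r := by
  simp only [psum, map_sum, map_pow, toRatSeries_X]

lemma toRatSeries_prod_psum (N : ℕ) {s : Multiset ℕ} (hs : ∀ r ∈ s, 0 < r) :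
    toRatSeries N (s.map (psum N)).prod =
      psEval N (s.map fun r => MvPolynomial.X (r - 1)).prod := by
  rw [map_multiset_prod, map_multiset_prod, Multiset.map_map, Multiset.map_map]
  refine congrArg _ (Multiset.map_congr rfl fun r hr => ?_)
  rw [Function.comp_apply, Function.comp_apply, toRatSeries_psum, psEval_X, Nat.sub_add_cancel (hs r hr)]

lemma coeff_sum_X_pow {N : ℕ} (M : ℕ) (v : Fin N →₀ ℕ) (hv : v.degree = M) :
    MvPowerSeries.coeff v ((∑ i, MvPowerSeries.X i : MvPowerSeries (Fin N) ℚ) ^ M) =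
      M.factorial * MvPowerSeries.coeff v (expSeries N) := by
  induction M generalizing v with
  | zero =>
    rw [Finsupp.degree_eq_zero_iff] at hv
    subst hv
    simp [coeff_expSeries]
  | succ M ih =>
    have h (i : Fin N) : MvPowerSeries.coeff v (MvPowerSeries.X i *
        (∑ i, MvPowerSeries.X i : MvPowerSeries (Fin N) ℚ) ^ M) =
        M.factorial * (v i * MvPowerSeries.coeff v (expSeries N)) := by
      rw [← coeff_eulerDer, eulerDer_expSeries, coeff_X_mul_eq_ite, coeff_X_mul_eq_ite]
      split_ifs with hi
      · refine ih _ ?_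
        have h1 : v - Finsupp.single i 1 + Finsupp.single i 1 = v :=
          tsub_add_cancel_of_le (by rw [Finsupp.single_le_iff]; exact hi)
        have h2 := congrArg Finsupp.degree h1
        rw [map_add, Finsupp.degree_single, hv] at h2
        omega
      · rw [mul_zero]
    have h1 : (∑ i, (v i : ℚ)) = M + 1 := by
      rw [← Nat.cast_sum, ← Finsupp.degree_eq_sum, hv, Nat.cast_succ]
    rw [pow_succ', sum_mul, map_sum, sum_congr rfl fun i _ => h i, ← mul_sum, ← sum_mul, h1,
      Nat.factorial_succ]
    push_cast
    ring

lemma coeff_mul_psum_one_pow {N d M : ℕ} {Q : MvPolynomial (Fin N) ℤ} (hQ : Q.IsHomogeneous d)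
    (l : Fin N →₀ ℕ) (hl : l.degree = d + M) :
    ((MvPolynomial.coeff l (Q * psum N 1 ^ M) : ℤ) : ℚ) =
      M.factorial * MvPowerSeries.coeff l (toRatSeries N Q * expSeries N) := by
  rw [← coeff_toRatSeries, map_mul, map_pow, toRatSeries_psum, MvPowerSeries.coeff_mul,
    MvPowerSeries.coeff_mul, mul_sum]
  refine sum_congr rfl fun x hx => ?_
  by_cases h : MvPolynomial.coeff x.1 Q = 0
  · rw [coeff_toRatSeries, h]
    simp
  · have h1 : x.1.degree = d := by
      rw [← hQ h, Finsupp.degree_eq_weight_one]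
      rfl
    have h2 := congrArg Finsupp.degree (mem_antidiagonal.1 hx)
    rw [map_add, h1, hl] at h2
    simp only [pow_one]
    rw [coeff_sum_X_pow M x.2 (by omega)]
    ring

lemma isHomogeneous_vdm (N : ℕ) : (vdm N).IsHomogeneous (∑ i : Fin N, (N - 1 - i)) := by
  refine MvPolynomial.IsHomogeneous.prod _ _ _ fun i _ => ?_
  have h : N - 1 - (i : ℕ) = ∑ j ∈ univ.filter (fun j => i < j), 1 := by
    rw [sum_const, smul_eq_mul, mul_one, show univ.filter (fun j => i < j) = Ioi i by ext; simp,
      Fin.card_Ioi]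
  rw [h]
  exact MvPolynomial.IsHomogeneous.prod _ _ _ fun j _ =>
    (MvPolynomial.isHomogeneous_X _ _).sub (MvPolynomial.isHomogeneous_X _ _)

lemma isHomogeneous_prod_psum (N : ℕ) (s : Multiset ℕ) :
    (s.map (psum N)).prod.IsHomogeneous s.sum := by
  induction s using Multiset.induction_on with
  | empty => simpa using MvPolynomial.isHomogeneous_one _ _
  | cons r s ih =>
    rw [Multiset.map_cons, Multiset.prod_cons, Multiset.sum_cons]
    refine MvPolynomial.IsHomogeneous.mul ?_ ih
    exact MvPolynomial.IsHomogeneous.sum _ _ _ fun i _ => MvPolynomial.isHomogeneous_X_pow _ _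

lemma sum_range_getD_zero (L : List ℕ) (n : ℕ) (h : L.length ≤ n) :
    ∑ i ∈ range n, L.getD i 0 = L.sum := by
  induction L generalizing n with
  | nil => simp
  | cons a L ih =>
    obtain ⟨n, rfl⟩ : ∃ k, n = k + 1 := ⟨n - 1, by simp at h; omega⟩
    rw [sum_range_succ', List.sum_cons]
    simp only [List.getD_cons_succ, List.getD_cons_zero]
    rw [ih n (by simpa using h), add_comm]

lemma card_parts_le {n : ℕ} (lam : n.Partition) : lam.parts.card ≤ n := by
  have h := Multiset.card_nsmul_le_sum (s := lam.parts) (a := 1) fun x hx => lam.parts_pos hx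
  rwa [lam.parts_sum, smul_eq_mul, mul_one] at h

lemma sum_nthPart {n : ℕ} (lam : n.Partition) : ∑ i : Fin n, nthPart lam i = n := by
  rw [Fin.sum_univ_eq_sum_range fun i => nthPart lam i]
  simp only [nthPart]
  rw [sum_range_getD_zero _ _ (by simpa using card_parts_le lam), List.sum_reverse,
    ← Multiset.sum_coe, Multiset.sort_eq, lam.parts_sum]

lemma nthPart_antitone {n : ℕ} (lam : n.Partition) : Antitone (nthPart lam) := by
  intro i j hij
  have hs : ((lam.parts.sort (· ≤ ·)).reverse).Pairwise (· ≥ ·) :=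
    List.pairwise_reverse.2 (Multiset.pairwise_sort _ _)
  simp only [nthPart]
  rcases lt_or_ge j ((lam.parts.sort (· ≤ ·)).reverse).length with hj | hj
  · rw [List.getD_eq_getElem _ _ hj, List.getD_eq_getElem _ _ (hij.trans_lt hj)]
    exact hs.rel_get_of_le (a := ⟨i, hij.trans_lt hj⟩) (b := ⟨j, hj⟩) hij
  · rw [List.getD_eq_default _ _ hj]
    exact Nat.zero_le _

/-- The exponent vector `λ + δ`, with `δ = (n - 1, …, 1, 0)`. -/
noncomputable def shiftedParts {n : ℕ} (lam : n.Partition) : Fin n →₀ ℕ :=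
  Finsupp.equivFunOnFinite.symm fun i : Fin n => nthPart lam i + (n - 1 - i)

lemma degree_shiftedParts {n : ℕ} (lam : n.Partition) :
    (shiftedParts lam).degree = n + ∑ i : Fin n, (n - 1 - i) := by
  rw [Finsupp.degree_eq_sum]
  simp only [shiftedParts, Finsupp.equivFunOnFinite_symm_apply_apply]
  rw [sum_add_distrib, sum_nthPart]

lemma shiftedParts_injective {n : ℕ} (lam : n.Partition) :
    Function.Injective (shiftedParts lam) := by
  have h (i j : Fin n) (hij : i < j) : shiftedParts lam j < shiftedParts lam i := by
    simp only [shiftedParts, Finsupp.equivFunOnFinite_symm_apply_apply]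
    have := nthPart_antitone lam (Fin.lt_def.1 hij).le
    have := Fin.lt_def.1 hij
    omega
  intro i j hij
  rcases lt_trichotomy i j with h1 | h1 | h1
  · exact absurd hij (h i j h1).ne'
  · exact h1
  · exact absurd hij (h j i h1).ne

lemma coeff_dimSeries_ne_zero {N : ℕ} {l : Fin N →₀ ℕ} (hl : Function.Injective l) :
    MvPowerSeries.coeff l (dimSeries N) ≠ 0 := by
  rw [coeff_dimSeries]
  exact mul_ne_zero (prod_ne_zero_iff.2 fun i _ => by positivity) (mul_ne_zero
    (vdmProd_ne_zero (Nat.cast_injective.comp hl)) (prod_ne_zero_iff.2 fun i _ => by positivity))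

lemma chi_eq_coeff_dimSeries {k n : ℕ} (h : k ≤ n) (lam : n.Partition) (mu : k.Partition)
    (nu : n.Partition) (hnu : nu.parts = mu.parts + Multiset.replicate (n - k) 1) :
    (chi n lam nu : ℚ) = (n - k).factorial * MvPowerSeries.coeff (shiftedParts lam)
      (dimSeries n * psEval n (mu.parts.map fun r => MvPolynomial.X (r - 1)).prod) := by
  have hQ := (isHomogeneous_vdm n).mul (isHomogeneous_prod_psum n mu.parts)
  rw [mu.parts_sum] at hQ
  have h1 := coeff_mul_psum_one_pow (M := n - k) hQ (shiftedParts lam)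
    (by rw [degree_shiftedParts]; omega)
  rw [map_mul (toRatSeries n), toRatSeries_vdm, toRatSeries_prod_psum n fun r hr => mu.parts_pos hr] at h1
  rw [chi, hnu, Multiset.map_add, Multiset.prod_add, Multiset.map_replicate, Multiset.prod_replicate,
    ← mul_assoc]
  refine h1.trans ?_
  rw [dimSeries, mul_right_comm]

/-- Normalized characters are integral polynomials in the coefficients of the content series. -/
theorem exists_chihat_eq_momentEval {k : ℕ} (mu : k.Partition) :
    ∃ W : MvPolynomial ℕ ℤ, ∀ (n : ℕ) (h : k ≤ n) (lam : n.Partition),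
      chihat n h lam mu = momentEval (shiftedParts lam) W := by
  obtain ⟨W, hW⟩ := exists_coeff_dimSeries_mul_psEval
    (mu.parts.map fun r => MvPolynomial.X (r - 1)).prod
  refine ⟨W, fun n h lam => ?_⟩
  have h1 := chi_eq_coeff_dimSeries h lam mu (padOnes n h mu) rfl
  have h2 := chi_eq_coeff_dimSeries n.zero_le lam (Nat.Partition.indiscrete 0) (onesPartition n)
    (by simp [onesPartition])
  rw [hW] at h1
  rw [show (Nat.Partition.indiscrete 0).parts = 0 by simp, Multiset.map_zero, Multiset.prod_zero,
    map_one, mul_one, Nat.sub_zero] at h2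
  have h3 := coeff_dimSeries_ne_zero (shiftedParts_injective lam)
  have h4 : (n.factorial : ℚ) ≠ 0 := by positivity
  rw [chihat, h1, h2, div_eq_iff (mul_ne_zero h4 h3), ← Nat.factorial_mul_descFactorial h]
  push_cast
  ring

end Characters

section Rectangles
open PowerSeries

/-- The list with `p` entries equal to `q` for each `(p, q)` of a list, in order. -/
def rectParts (L : List (ℕ × ℕ)) : List ℕ := L.flatMap fun x => List.replicate x.1 x.2

/-- The content series of a stack of rectangles `p × q` starting in row `s`. -/
noncomputable def rectSeries {A : Type*} [CommRing A] : A → List (A × A) → A⟦X⟧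
  | s, [] => 1 + C s * X
  | s, x :: L => (1 - C (x.2 - s) * X) * geomSeries (x.2 - s - x.1) * rectSeries (s + x.1) L

lemma map_rectSeries {A B : Type*} [CommRing A] [CommRing B] (φ : A →+* B) (s : A)
    (L : List (A × A)) :
    map φ (rectSeries s L) = rectSeries (φ s) (L.map (Prod.map φ φ)) := by
  induction L generalizing s with
  | nil => simp [rectSeries]
  | cons x L ih => simp [rectSeries, ih, map_geomSeries]

lemma prod_range_replicate (s q : ℚ) (p : ℕ) :
    ∏ j ∈ range p, ((1 - C (q - (s + j)) * X) * geomSeries (q - (s + j) - 1)) =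
      (1 - C (q - s) * X) * geomSeries (q - s - p) := by
  induction p with
  | zero => rw [prod_range_zero, Nat.cast_zero, sub_zero, one_sub_mul_geomSeries]
  | succ p ih =>
    rw [prod_range_succ, ih, show q - (s + p) = q - s - p by ring]
    have h := one_sub_mul_geomSeries (q - s - p)
    push_cast
    rw [show q - s - (p + 1) = q - s - p - 1 by ring]
    linear_combination (1 - C (q - s) * X) * geomSeries (q - s - p - 1) * h

lemma prod_range_rectParts (L : List (ℕ × ℕ)) (s : ℚ) (n : ℕ) (hn : (rectParts L).length ≤ n) :
    ∏ i ∈ range n, ((1 - C (((rectParts L).getD i 0 : ℚ) - (s + i)) * X) *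
      geomSeries (((rectParts L).getD i 0 : ℚ) - (s + i) - 1)) =
      rectSeries s (L.map (Prod.map Nat.cast Nat.cast)) * geomSeries (-s - n) := by
  induction L generalizing s n with
  | nil => simpa [rectParts, rectSeries] using prod_range_replicate s 0 n
  | cons x L ih =>
    have hx : rectParts (x :: L) = List.replicate x.1 x.2 ++ rectParts L := by simp [rectParts]
    rw [hx, List.length_append, List.length_replicate] at hn
    obtain ⟨n, rfl⟩ := Nat.exists_eq_add_of_le ((Nat.le_add_right _ _).trans hn)
    rw [hx, prod_range_add]
    have h1 : ∀ i ∈ range x.1, (List.replicate x.1 x.2 ++ rectParts L).getD i 0 = x.2 := by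
      intro i hi
      rw [List.getD_append _ _ _ _ (by simpa using hi), List.getD_replicate _ (mem_range.1 hi)]
    have h2 (i : ℕ) : (List.replicate x.1 x.2 ++ rectParts L).getD (x.1 + i) 0 =
        (rectParts L).getD i 0 := by
      rw [List.getD_append_right _ _ _ _ (by simp)]
      simp
    rw [prod_congr rfl fun i hi => by rw [h1 i hi], prod_range_replicate]
    simp only [h2]
    have h3 := ih (s + x.1) n (by omega)
    have h4 (i : ℕ) : s + ((x.1 + i : ℕ) : ℚ) = s + x.1 + i := by push_cast; ring
    simp only [h4]
    rw [h3, List.map_cons, rectSeries]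
    simp only [Prod.map_fst, Prod.map_snd]
    rw [show -(s + (x.1 : ℚ)) - n = -s - ((x.1 + n : ℕ) : ℚ) by push_cast; ring]
    ring

lemma contentSeries_shiftedParts {n : ℕ} (lam : n.Partition) (L : List (ℕ × ℕ))
    (hL : lam.parts = rectParts L) (hs : (rectParts L).Pairwise (· ≥ ·)) :
    contentSeries (shiftedParts lam) = rectSeries 0 (L.map (Prod.map Nat.cast Nat.cast)) := by
  have h1 : (lam.parts.sort (· ≤ ·)).reverse = rectParts L := by
    refine List.Perm.eq_of_pairwise' (r := (· ≥ ·))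
      (List.pairwise_reverse.2 (Multiset.pairwise_sort _ _)) hs ?_
    rw [← Multiset.coe_eq_coe, ← hL, Multiset.coe_reverse, Multiset.sort_eq]
  have h2 : (rectParts L).length ≤ n := by
    have := card_parts_le lam
    rwa [hL, Multiset.coe_card] at this
  have h3 (i : Fin n) : ((shiftedParts lam i : ℕ) : ℚ) - n =
      ((rectParts L).getD i 0 : ℚ) - (0 + (i : ℕ)) - 1 := by
    simp only [shiftedParts, Finsupp.equivFunOnFinite_symm_apply_apply, nthPart, h1]
    have hi := i.isLt
    rw [Nat.sub_sub, Nat.cast_add, Nat.cast_sub (by omega)]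
    push_cast
    ring
  have h4 := prod_range_rectParts L 0 n h2
  rw [contentSeries]
  simp only [h3, sub_add_cancel]
  rw [Fin.prod_univ_eq_prod_range fun i : ℕ => (1 - C (((rectParts L).getD i 0 : ℚ) - (0 + i)) * X) *
      geomSeries (((rectParts L).getD i 0 : ℚ) - (0 + i) - 1), h4]
  have h5 := one_sub_mul_geomSeries (-0 - (n : ℚ))
  rw [neg_zero, zero_sub, map_neg, neg_mul, sub_neg_eq_add] at h5
  rw [neg_zero, zero_sub]
  linear_combination rectSeries 0 (L.map (Prod.map Nat.cast Nat.cast)) * h5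

lemma rectShape_parts (m : ℕ) (p q : Fin m → ℕ) (hq : ∀ i, 0 < q i) :
    (rectShape m p q hq).parts = rectParts (List.ofFn fun i => (p i, q i)) := by
  have h (L : List (ℕ × ℕ)) : (rectParts L : Multiset ℕ) =
      (L.map fun x => Multiset.replicate x.1 x.2).sum := by
    induction L with
    | nil => rfl
    | cons x L ih =>
      rw [List.map_cons, List.sum_cons, ← ih]
      rw [← Multiset.coe_replicate, Multiset.coe_add]
      rfl
  rw [h, List.map_ofFn, List.sum_ofFn]
  rfl

lemma pairwise_rectParts_ofFn {m : ℕ} {p q : Fin m → ℕ} (hq : Antitone q) :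
    (rectParts (List.ofFn fun i => (p i, q i))).Pairwise (· ≥ ·) := by
  rw [rectParts, List.pairwise_flatMap]
  refine ⟨fun x _ => List.pairwise_replicate.2 (Or.inr le_rfl), ?_⟩
  rw [List.pairwise_ofFn]
  intro i j hij a ha b hb
  rw [List.eq_of_mem_replicate ha, List.eq_of_mem_replicate hb]
  exact hq hij.le

end Rectangles

/-- For a fixed partition `μ` of `k ≥ 1`, the normalized character
`F_μ(p₁,…,p_m; q₁,…,q_m) = χ̂^λ(μ,1^{n-k})`, where `λ` is the union of `m` rectangles
`pᵢ × qᵢ` with `q₁ ≥ ⋯ ≥ q_m` and `n = ∑ pᵢqᵢ ≥ k`, is a polynomial function of the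
`pᵢ`'s and `qᵢ`'s with integer coefficients. -/
theorem stmt0 (k m : ℕ) (hk : 1 ≤ k) (hm : 1 ≤ m) (mu : Nat.Partition k) :
    ∃ P : MvPolynomial (Fin m ⊕ Fin m) ℤ,
      ∀ (p q : Fin m → ℕ) (hp : ∀ i, 0 < p i) (hq : ∀ i, 0 < q i)
        (hmono : Antitone q) (hkn : k ≤ rectN m p q),
          chihat (rectN m p q) hkn (rectShape m p q hq) mu =
            ((MvPolynomial.eval (Sum.elim (fun i => (p i : ℤ)) fun i => (q i : ℤ)) P : ℤ) : ℚ) := by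
  obtain ⟨W, hW⟩ := exists_chihat_eq_momentEval mu
  let L : List (MvPolynomial (Fin m ⊕ Fin m) ℤ × MvPolynomial (Fin m ⊕ Fin m) ℤ) := List.ofFn fun i =>
    (MvPolynomial.X (Sum.inl i), MvPolynomial.X (Sum.inr i))
  refine ⟨MvPolynomial.aeval (fun n => PowerSeries.coeff n (rectSeries 0 L)) W,
    fun p q hp hq hmono hkn => ?_⟩
  let φ : MvPolynomial (Fin m ⊕ Fin m) ℤ →+* ℚ := (Int.castRingHom ℚ).comp
    (MvPolynomial.eval (Sum.elim (fun i => (p i : ℤ)) fun i => (q i : ℤ)))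
  have hφ : PowerSeries.map φ (rectSeries 0 L) =
      contentSeries (shiftedParts (rectShape m p q hq)) := by
    rw [contentSeries_shiftedParts _ _ (rectShape_parts m p q hq) (pairwise_rectParts_ofFn hmono),
      map_rectSeries, map_zero, List.map_ofFn, List.map_ofFn]
    congr 2
    funext i
    simp [φ]
  rw [hW]
  change _ = φ _
  clear hW
  induction W using MvPolynomial.induction_on with
  | C a => simp
  | add f g hf hg => rw [map_add, map_add, map_add, hf, hg]
  | mul_X f n hf =>
    rw [map_mul, map_mul, map_mul, hf, MvPolynomial.aeval_X, momentEval, MvPolynomial.aeval_X, ← hφ,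
      PowerSeries.coeff_map]
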